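/- Every complete fan Δ is quasi-convex: for a minimal extension sheaf E• on a complete fan Δ, the A•-module E•(Δ) of global sections is free. -/

import Mathlib

open Module Function

set_option synthInstance.maxHeartbeats 1000000
set_option maxHeartbeats 1000000
set_option maxSynthPendingDepth 3

noncomputable section

/-! ## Cones and fans -/

/-- The convex cone generated by a finite set of vectors. -/
def coneGen {V : Type} [AddCommGroup V] [Module ℝ V] (s : Finset V) : Set V :=
  { x | ∃ c : V → ℝ, (∀ v ∈ s, 0 ≤ c v) ∧ x = ∑ v ∈ s, c v • v }

/-- A (strictly convex, i.e. pointed) polyhedral cone in a real vector space. -/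
structure Cone (V : Type) [AddCommGroup V] [Module ℝ V] where
  carrier : Set V
  isPoly : ∃ s : Finset V, carrier = coneGen s
  pointed : ∀ x ∈ carrier, -x ∈ carrier → x = 0

namespace Cone

variable {V : Type} [AddCommGroup V] [Module ℝ V]

/-- The linear span `V_σ` of a cone. -/
def spanC (σ : Cone V) : Submodule ℝ V := Submodule.span ℝ σ.carrier

/-- The dimension of a cone. -/
def dim (σ : Cone V) : ℕ := Module.finrank ℝ σ.spanC

/-- `τ` is a face of `σ` (cut out by a supporting linear form); `σ` is a face of itself. -/
def IsFaceOf (τ σ : Cone V) : Prop :=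
  ∃ f : V →ₗ[ℝ] ℝ, (∀ x ∈ σ.carrier, 0 ≤ f x) ∧
    τ.carrier = σ.carrier ∩ {x | f x = 0}

def IsProperFaceOf (τ σ : Cone V) : Prop := τ.IsFaceOf σ ∧ τ ≠ σ

/-- A cone is simplicial if it is generated by linearly independent vectors. -/
def IsSimplicial (σ : Cone V) : Prop :=
  ∃ s : Finset V, (LinearIndependent ℝ (fun v : s => (v : V))) ∧ σ.carrier = coneGen s

end Cone

/-- The zero cone `o`. -/
def zeroCone (V : Type) [AddCommGroup V] [Module ℝ V] : Cone V where
  carrier := {0}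
  isPoly := ⟨∅, by ext x; simp [coneGen]⟩
  pointed := by intro x hx _; simpa using hx

/-- A fan in `V`: a finite collection of pointed polyhedral cones, closed under taking
faces, such that the intersection of any two cones is a common face of both. -/
structure Fan (V : Type) [AddCommGroup V] [Module ℝ V] where
  cones : Set (Cone V)
  finite : cones.Finite
  zero_mem : zeroCone V ∈ cones
  face_mem : ∀ σ ∈ cones, ∀ τ : Cone V, τ.IsFaceOf σ → τ ∈ cones
  inter_mem : ∀ σ ∈ cones, ∀ σ' ∈ cones, ∃ τ ∈ cones,
    τ.IsFaceOf σ ∧ τ.IsFaceOf σ' ∧ τ.carrier = σ.carrier ∩ σ'.carrier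

namespace Fan

variable {V : Type} [AddCommGroup V] [Module ℝ V]

/-- A subfan of `Δ`: a subset of the cones closed under taking faces.  The subfans are
exactly the open subsets of the fan topology. -/
def IsSubfan (Δ : Fan V) (Λ : Set (Cone V)) : Prop :=
  Λ ⊆ Δ.cones ∧ ∀ σ ∈ Λ, ∀ τ : Cone V, τ.IsFaceOf σ → τ ∈ Λ

/-- The support `|Δ|` of a fan. -/
def support (Δ : Fan V) : Set V := ⋃ σ ∈ Δ.cones, σ.carrier

/-- A fan is complete if its support is the whole space. -/
def IsComplete (Δ : Fan V) : Prop := Δ.support = Set.univ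

/-- A fan is simplicial if all its cones are. -/
def IsSimplicial (Δ : Fan V) : Prop := ∀ σ ∈ Δ.cones, σ.IsSimplicial

/-- A fan is purely `n`-dimensional if every cone is a face of an `n`-dimensional cone. -/
def IsPurely (Δ : Fan V) (n : ℕ) : Prop :=
  ∀ σ ∈ Δ.cones, ∃ σ' ∈ Δ.cones, σ.IsFaceOf σ' ∧ σ'.dim = n

/-- The boundary subfan `∂Δ`: the cones supported in the topological boundary of `|Δ|`. -/
def boundary [TopologicalSpace V] (Δ : Fan V) : Set (Cone V) :=
  {τ ∈ Δ.cones | τ.carrier ⊆ frontier Δ.support}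

end Fan

/-! ## The graded algebra `A•` of polynomial functions (linear forms in degree 2) -/

/-- The algebra of polynomial functions on `V`, i.e. the subalgebra of `V → ℝ`
generated by the linear forms. -/
def polyAlg (V : Type) [AddCommGroup V] [Module ℝ V] : Subalgebra ℝ (V → ℝ) :=
  Algebra.adjoin ℝ {f : V → ℝ | IsLinearMap ℝ f}

/-- `A• = S•(V*)` as a commutative ring. -/
abbrev PolyRing (V : Type) [AddCommGroup V] [Module ℝ V] : Type := polyAlg V

variable (V : Type) [AddCommGroup V] [Module ℝ V]

/-- Polynomial functions homogeneous of (topological) degree `2k`. -/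
def AdegN (k : ℕ) : Submodule ℝ (PolyRing V) where
  carrier := {f | ∀ (t : ℝ) (x : V), (f : V → ℝ) (t • x) = t ^ k * (f : V → ℝ) x}
  add_mem' := by intro f g hf hg t x; simp [hf t x, hg t x]; ring
  zero_mem' := by intro t x; simp
  smul_mem' := by intro c f hf t x; simp [hf t x]; ring

/-- The degree-`q` part `A^q` of `A•`, with linear forms in degree `2`
(so `A^q = 0` for odd `q`). -/
def Adeg (q : ℤ) : Submodule ℝ (PolyRing V) :=
  ⨆ (k : ℕ) (_ : q = 2 * k), AdegN V k

/-- Evaluation of a polynomial function at a point, as a ring homomorphism. -/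
def evalRH (x : V) : PolyRing V →+* ℝ :=
  (Pi.evalRingHom (fun _ : V => ℝ) x).comp (polyAlg V).val.toRingHom

/-- The maximal graded ideal `m = A^{>0}` of polynomial functions vanishing at the origin. -/
def mId : Ideal (PolyRing V) := RingHom.ker (evalRH V 0)

/-- The ideal of polynomial functions vanishing on a subset `s ⊆ V`;
for `s = σ` a cone, `A•/I(σ) = A•_σ = S•(V_σ*)`. -/
def vanishingIdeal (s : Set V) : Ideal (PolyRing V) :=
  RingHom.ker (Pi.ringHom (fun x : s => evalRH V x.1))

/-- `A•_σ`, realized as the quotient of `A•` by the functions vanishing on `σ`. -/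
abbrev coneRing (σ : Cone V) : Type := PolyRing V ⧸ vanishingIdeal V σ.carrier

/-! ## Graded `A•`-modules -/

/-- A graded `A•`-module (with real structure): an `A•`-module with an internal
`ℤ`-grading by real subspaces, compatible with the grading of `A•`. -/
structure GAMod where
  M : Type
  [acg : AddCommGroup M]
  [modA : Module (PolyRing V) M]
  [modR : Module ℝ M]
  [tower : IsScalarTower ℝ (PolyRing V) M]
  deg : ℤ → Submodule ℝ M
  internal : DirectSum.IsInternal deg
  smul_deg : ∀ (p q : ℤ), ∀ a ∈ Adeg V p, ∀ x ∈ deg q, a • x ∈ deg (p + q)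

attribute [instance] GAMod.acg GAMod.modA GAMod.modR GAMod.tower

variable {V}

/-- A homomorphism of graded `A•`-modules, homogeneous of degree 0. -/
structure GHom (M N : GAMod V) where
  toLin : M.M →ₗ[PolyRing V] N.M
  deg_mem : ∀ q : ℤ, ∀ x ∈ M.deg q, toLin x ∈ N.deg q

def GHom.id (M : GAMod V) : GHom M M := ⟨LinearMap.id, fun _ _ h => h⟩

def GHom.comp {M N P : GAMod V} (g : GHom N P) (f : GHom M N) : GHom M P :=
  ⟨g.toLin ∘ₗ f.toLin, fun q x hx => g.deg_mem q _ (f.deg_mem q x hx)⟩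

variable (V)

/-- `M` is (the `A•`-module underlying) a free `A•_σ`-module. -/
def FreeOverCone (σ : Cone V) (M : Type) [AddCommGroup M] [Module (PolyRing V) M] : Prop :=
  ∃ h : Module.IsTorsionBySet (PolyRing V) M (vanishingIdeal V σ.carrier),
    letI := h.module
    Module.Free (coneRing V σ) M

/-! ## Reduction modulo the maximal graded ideal -/

/-- The submodule `m·M`. -/
def mSub (M : Type) [AddCommGroup M] [Module (PolyRing V) M] :
    Submodule (PolyRing V) M := (mId V) • (⊤ : Submodule (PolyRing V) M)

/-- The reduction `M̄ = M/mM`. -/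
abbrev mRed (M : Type) [AddCommGroup M] [Module (PolyRing V) M] : Type := M ⧸ mSub V M

lemma mSub_le_comap {M N : Type} [AddCommGroup M] [Module (PolyRing V) M]
    [AddCommGroup N] [Module (PolyRing V) N] (f : M →ₗ[PolyRing V] N) :
    mSub V M ≤ (mSub V N).comap f := by
  rw [mSub, Submodule.smul_le]
  intro r hr x _
  simp only [Submodule.mem_comap, map_smul]
  exact Submodule.smul_mem_smul hr trivial

/-- The reduced map `M̄ → N̄` induced by an `A•`-linear map. -/
def mRedMap {M N : Type} [AddCommGroup M] [Module (PolyRing V) M]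
    [AddCommGroup N] [Module (PolyRing V) N] (f : M →ₗ[PolyRing V] N) :
    mRed V M →ₗ[PolyRing V] mRed V N :=
  Submodule.mapQ _ _ f (mSub_le_comap V f)

/-- The image in `M̄` of an `ℝ`-subspace of `M` (e.g. of a graded piece). -/
def mRedPiece {M : Type} [AddCommGroup M] [Module (PolyRing V) M] [Module ℝ M]
    [IsScalarTower ℝ (PolyRing V) M] (p : Submodule ℝ M) : Submodule ℝ (mRed V M) :=
  p.map ((mSub V M).mkQ.restrictScalars ℝ)

/-! ## Sheaves of graded `A•`-modules on a fan -/

open scoped Classical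

/-- The zero cone as an element of a fan. -/
def Fan.ozero {V : Type} [AddCommGroup V] [Module ℝ V] (Δ : Fan V) : Δ.cones :=
  ⟨zeroCone V, Δ.zero_mem⟩


variable {V}

/-- A sheaf of graded `A•`-modules on the fan space `Δ`, given (as the fan topology
dictates) by its stalks on the cones together with compatible restriction maps. -/
structure FanSheaf (Δ : Fan V) where
  stalk : Δ.cones → GAMod V
  res : ∀ σ τ : Δ.cones, Cone.IsFaceOf τ.1 σ.1 → GHom (stalk σ) (stalk τ)
  res_self : ∀ (σ : Δ.cones) (h : Cone.IsFaceOf σ.1 σ.1), (res σ σ h).toLin = LinearMap.id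
  res_comp : ∀ (σ τ υ : Δ.cones) (h1 : Cone.IsFaceOf τ.1 σ.1) (h2 : Cone.IsFaceOf υ.1 τ.1)
      (h3 : Cone.IsFaceOf υ.1 σ.1),
      (res τ υ h2).toLin ∘ₗ (res σ τ h1).toLin = (res σ υ h3).toLin

namespace FanSheaf

variable {Δ : Fan V} (F : FanSheaf Δ)

/-- The sections of `F` over a collection `Λ` of cones of `Δ` (e.g. a subfan):
compatible families of elements of the stalks over `Λ`, extended by zero. -/
def secSub (Λ : Set (Cone V)) :
    Submodule (PolyRing V) (∀ σ : Δ.cones, (F.stalk σ).M) where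
  carrier := { s | (∀ σ : Δ.cones, σ.1 ∉ Λ → s σ = 0) ∧
    ∀ (σ τ : Δ.cones), σ.1 ∈ Λ → τ.1 ∈ Λ → ∀ h : Cone.IsFaceOf τ.1 σ.1,
      (F.res σ τ h).toLin (s σ) = s τ }
  add_mem' := by
    rintro a b ⟨ha0, ha⟩ ⟨hb0, hb⟩
    refine ⟨fun σ hσ => by simp [ha0 σ hσ, hb0 σ hσ], fun σ τ hσ hτ h => ?_⟩
    simp [map_add, ha σ τ hσ hτ h, hb σ τ hσ hτ h]
  zero_mem' := ⟨fun _ _ => rfl, fun σ τ _ _ h => by simp⟩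
  smul_mem' := by
    rintro c a ⟨ha0, ha⟩
    refine ⟨fun σ hσ => by simp [ha0 σ hσ], fun σ τ hσ hτ h => ?_⟩
    simp [map_smul, ha σ τ hσ hτ h]

/-- The `A•`-module of sections of `F` over `Λ`. -/
abbrev Sec (Λ : Set (Cone V)) : Type := F.secSub Λ

/-- The global sections `E•(Δ)`. -/
abbrev globalSec : Type := F.Sec Δ.cones

/-- The degree-`q` part of the module of sections. -/
def secDeg (Λ : Set (Cone V)) (q : ℤ) : Submodule ℝ (F.Sec Λ) where
  carrier := { s | ∀ σ : Δ.cones, s.1 σ ∈ (F.stalk σ).deg q }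
  add_mem' := by intro a b ha hb σ; exact add_mem (ha σ) (hb σ)
  zero_mem' := fun σ => zero_mem _
  smul_mem' := by intro c a ha σ; exact Submodule.smul_mem _ c (ha σ)

/-- Restriction of sections to a smaller collection of cones. -/
def resSec (Λ' Λ : Set (Cone V)) (hΛ : Λ ⊆ Λ') : F.Sec Λ' →ₗ[PolyRing V] F.Sec Λ where
  toFun s := ⟨fun σ => if σ.1 ∈ Λ then s.1 σ else 0, by
    classical
    refine ⟨fun σ hσ => by simp [hσ], fun σ τ hσ hτ h => ?_⟩
    simp only [hσ, hτ, if_pos]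
    exact s.2.2 σ τ (hΛ hσ) (hΛ hτ) h⟩
  map_add' a b := by
    apply Subtype.ext; funext σ; by_cases h : σ.1 ∈ Λ <;> simp [h]
  map_smul' c a := by
    apply Subtype.ext; funext σ; by_cases h : σ.1 ∈ Λ <;> simp [h]

/-- A sheaf is flabby if all restrictions from global sections to subfans are surjective. -/
def Flabby : Prop :=
  ∀ Λ : Set (Cone V), ∀ h : Δ.IsSubfan Λ, Function.Surjective (F.resSec Δ.cones Λ h.1)

/-- The boundary fan `∂σ` of a cone of `Δ`, as a set of cones. -/
def bdFan (σ : Δ.cones) : Set (Cone V) := {τ : Cone V | τ.IsProperFaceOf σ.1}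

/-- The restriction map `E•_σ → E•_{∂σ}` from the stalk to the sections over the
boundary fan of `σ`. -/
def bdRes (σ : Δ.cones) : (F.stalk σ).M →ₗ[PolyRing V] F.Sec (bdFan σ) where
  toFun x := ⟨fun τ => if h : Cone.IsProperFaceOf τ.1 σ.1 then (F.res σ τ h.1).toLin x else 0, by
    refine ⟨fun τ hτ => by simp [bdFan] at hτ; simp [hτ], ?_⟩
    intro τ υ hτ hυ h
    simp only [bdFan, Set.mem_setOf_eq] at hτ hυ
    simp only [dif_pos hτ, dif_pos hυ]
    rw [← F.res_comp σ τ υ hτ.1 h hυ.1]; rfl⟩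
  map_add' a b := by
    apply Subtype.ext; funext τ
    by_cases h : Cone.IsProperFaceOf τ.1 σ.1 <;> simp [h]
  map_smul' c a := by
    apply Subtype.ext; funext τ
    by_cases h : Cone.IsProperFaceOf τ.1 σ.1 <;> simp [h]

/-- The reduced restriction map `Ē•_σ → Ē•_{∂σ}` modulo `m`. -/
def bdResRed (σ : Δ.cones) :
    mRed V (F.stalk σ).M →ₗ[PolyRing V] mRed V (F.Sec (bdFan σ)) :=
  mRedMap V (F.bdRes σ)

/-- Condition (N): `E•_o ≅ A•_o = ℝ•`, i.e. the stalk at the zero cone is the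
trivial one-dimensional graded module concentrated in degree `0`. -/
def CondN : Prop :=
  Module.IsTorsionBySet (PolyRing V) (F.stalk Δ.ozero).M (mId V : Set (PolyRing V)) ∧
  Module.finrank ℝ (F.stalk Δ.ozero).M = 1 ∧
  ∀ q : ℤ, q ≠ 0 → (F.stalk Δ.ozero).deg q = ⊥

/-- Condition (PF): each stalk `E•_σ` is a free `A•_σ`-module. -/
def CondPF : Prop := ∀ σ : Δ.cones, FreeOverCone V σ.1 (F.stalk σ).M

/-- Condition (LME): for each nonzero cone `σ`, the restriction `E•_σ → E•_{∂σ}`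
induces, modulo `m`, an isomorphism of graded real vector spaces. -/
def CondLME : Prop :=
  ∀ σ : Δ.cones, σ.1 ≠ zeroCone V → ∀ q : ℤ,
    Set.BijOn (F.bdResRed σ)
      (mRedPiece V ((F.stalk σ).deg q) : Set (mRed V (F.stalk σ).M))
      (mRedPiece V (M := F.Sec (bdFan σ)) (F.secDeg (bdFan σ) q) : Set (mRed V (F.Sec (bdFan σ))))

/-- A minimal extension sheaf on the fan `Δ`. -/
def IsMES : Prop := F.CondN ∧ F.CondPF ∧ F.CondLME

end FanSheaf


namespace QC

/-! ### Weyl's theorem -/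

lemma mem_coneGen_insert (s : Finset V) (v : V) (hv : v ∉ s) (x : V) :
    x ∈ coneGen (insert v s) ↔ ∃ t : ℝ, 0 ≤ t ∧ x - t • v ∈ coneGen s := by
  constructor
  · rintro ⟨c, hc, rfl⟩
    refine ⟨c v, hc v (by simp), c, fun w hw => hc w (by simp [hw]), ?_⟩
    rw [Finset.sum_insert hv]; simp
  · rintro ⟨t, ht, c, hc, h⟩
    refine ⟨fun w => if w = v then t else c w, ?_, ?_⟩
    · intro w hw
      by_cases h' : w = v
      · simp [h', ht]
      · simp only [h', if_false]; exact hc w (by simpa [h'] using hw)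
    · rw [Finset.sum_insert hv]
      have : ∑ w ∈ s, (if w = v then t else c w) • w = ∑ w ∈ s, c w • w := by
        apply Finset.sum_congr rfl
        intro w hw
        have : w ≠ v := fun e => hv (e ▸ hw)
        simp [this]
      rw [this, ← h]; simp

theorem weyl [FiniteDimensional ℝ V] (s : Finset V) :
    ∃ L : Finset (V →ₗ[ℝ] ℝ), ∀ x, x ∈ coneGen s ↔ ∀ f ∈ L, 0 ≤ f x := by
  induction s using Finset.induction_on with
  | empty =>
    let b := Module.finBasis ℝ V
    refine ⟨Finset.univ.image (fun i => b.coord i) ∪ Finset.univ.image (fun i => - b.coord i), ?_⟩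
    intro x
    constructor
    · rintro ⟨c, -, rfl⟩; simp
    · intro h
      have : x = 0 := by
        apply b.ext_elem
        intro i
        have h1 := h (b.coord i) (by simp)
        have h2 := h (- b.coord i) (by simp)
        simp at h1 h2
        simp; linarith
      exact ⟨0, by simp, by simp [this]⟩
  | insert v s hv ih =>
    obtain ⟨L, hL⟩ := ih
    refine ⟨L.filter (fun f => 0 ≤ f v) ∪
      ((L.filter (fun f => 0 ≤ f v)) ×ˢ (L.filter (fun f => f v < 0))).image
        (fun p => (p.1 v) • p.2 - (p.2 v) • p.1), ?_⟩
    intro x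
    rw [mem_coneGen_insert s v hv]
    constructor
    · rintro ⟨t, ht, h⟩
      rw [hL] at h
      intro f hf
      rw [Finset.mem_union] at hf
      rcases hf with hf | hf
      · rw [Finset.mem_filter] at hf
        have := h f hf.1
        simp at this
        have h2 : 0 ≤ t * f v := mul_nonneg ht hf.2
        linarith
      · rw [Finset.mem_image] at hf
        obtain ⟨⟨f, g⟩, hfg, rfl⟩ := hf
        simp only [Finset.mem_product, Finset.mem_filter] at hfg
        have h1 := h f hfg.1.1
        have h2 := h g hfg.2.1
        simp at h1 h2 ⊢
        nlinarith [hfg.1.2, hfg.2.2]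
    · intro h
      let N : Finset ℝ := insert 0 ((L.filter (fun f => f v < 0)).image (fun g => g x / g v))
      have hN : N.Nonempty := ⟨0, by simp [N]⟩
      refine ⟨N.max' hN, N.le_max' 0 (by simp [N]), ?_⟩
      have hmem := N.max'_mem hN
      have hle : ∀ y ∈ N, y ≤ N.max' hN := fun y hy => N.le_max' y hy
      generalize N.max' hN = t at hmem hle
      rw [hL]
      intro f hf
      simp only [map_sub, map_smul, smul_eq_mul]
      by_cases hfv : 0 ≤ f v
      · simp only [N, Finset.mem_insert, Finset.mem_image, Finset.mem_filter] at hmem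
        rcases hmem with rfl | ⟨g, ⟨hg, hgv⟩, rfl⟩
        · have := h f (by simp [hf, hfv])
          simpa using this
        · have := h ((f v) • g - (g v) • f) (by
            apply Finset.mem_union_right
            rw [Finset.mem_image]
            exact ⟨(f, g), by simp [hf, hfv, hg, hgv], rfl⟩)
          simp at this
          rw [div_mul_eq_mul_div, sub_nonneg, div_le_iff_of_neg hgv]
          linarith
      · push Not at hfv
        have := hle (f x / f v) (by
          simp only [N, Finset.mem_insert, Finset.mem_image, Finset.mem_filter]
          exact Or.inr ⟨f, ⟨hf, hfv⟩, rfl⟩)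
        rw [div_le_iff_of_neg hfv] at this
        linarith

/-! ### Conformal decompositions -/

/-- `r` lies in the closed sign cell of `y`. -/
def Conf (L : Finset (V →ₗ[ℝ] ℝ)) (r y : V) : Prop :=
  ∀ f ∈ L, (0 ≤ f y → 0 ≤ f r) ∧ (f y ≤ 0 → f r ≤ 0)

lemma Conf.trans {L : Finset (V →ₗ[ℝ] ℝ)} {a b c : V} (h : Conf L a b) (h' : Conf L b c) :
    Conf L a c := fun f hf =>
  ⟨fun x => (h f hf).1 ((h' f hf).1 x), fun x => (h f hf).2 ((h' f hf).2 x)⟩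

/-- number of forms not vanishing at `y` -/
def nz (L : Finset (V →ₗ[ℝ] ℝ)) (y : V) : ℕ := (L.filter (fun f => f y ≠ 0)).card

/-- reduction step: subtract a positive multiple of `w` until some form hits zero. -/
lemma conf_step (L : Finset (V →ₗ[ℝ] ℝ)) (y w : V)
    (hz : ∀ f ∈ L, f y = 0 → f w = 0) (hw : ∃ f ∈ L, 0 < f w * f y) :
    ∃ t : ℝ, 0 < t ∧ Conf L (y - t • w) y ∧ nz L (y - t • w) < nz L y := by
  obtain ⟨f0, hf0, hf0'⟩ := hw
  let S := L.filter (fun f => 0 < f w * f y)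
  obtain ⟨f1, hf1, hmin⟩ := S.exists_min_image (fun f => f y / f w) ⟨f0, by simp [S, hf0, hf0']⟩
  simp only [S, Finset.mem_filter] at hf1 hmin
  have hf1w : f1 w ≠ 0 := by intro h; simp [h] at hf1
  have hf1y : f1 y ≠ 0 := by intro h; simp [h] at hf1
  have ht : 0 < f1 y / f1 w := by
    have : f1 y / f1 w = (f1 w * f1 y) / (f1 w) ^ 2 := by field_simp
    rw [this]; exact div_pos hf1.2 (by positivity)
  refine ⟨f1 y / f1 w, ht, ?_, ?_⟩
  · generalize f1 y / f1 w = t at ht hmin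
    intro f hf
    have key : 0 < f w * f y → (0 < f y → t * f w ≤ f y) ∧ (f y < 0 → f y ≤ t * f w) := by
      intro hp
      have h := hmin f ⟨hf, hp⟩
      constructor
      · intro hy
        have : 0 < f w := by nlinarith
        rwa [le_div_iff₀ this] at h
      · intro hy
        have : f w < 0 := by nlinarith
        rwa [le_div_iff_of_neg this] at h
    simp only [map_sub, map_smul, smul_eq_mul]
    constructor
    · intro hy
      rcases hy.eq_or_lt with hy | hy
      · rw [hz f hf hy.symm, ← hy]; simp
      · by_cases hp : 0 < f w * f y
        · linarith [(key hp).1 hy]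
        · have : f w ≤ 0 := by
            by_contra hh; push Not at hh; exact hp (mul_pos hh hy)
          nlinarith
    · intro hy
      rcases hy.eq_or_lt with hy | hy
      · rw [hz f hf hy, hy]; simp
      · by_cases hp : 0 < f w * f y
        · linarith [(key hp).2 hy]
        · have : 0 ≤ f w := by
            by_contra hh; push Not at hh; exact hp (mul_pos_of_neg_of_neg hh hy)
          nlinarith
  · apply Finset.card_lt_card
    rw [Finset.ssubset_iff_of_subset]
    · refine ⟨f1, by simp [hf1.1, hf1y], ?_⟩
      simp only [Finset.mem_filter, not_and, not_not]
      intro _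
      simp only [map_sub, map_smul, smul_eq_mul]
      field_simp; simp
    · intro f hf
      simp only [Finset.mem_filter] at hf ⊢
      refine ⟨hf.1, fun h => hf.2 ?_⟩
      simp [h, hz f hf.1 h]

/-- The set of one-dimensional-flat vectors. -/
def Elem (L : Finset (V →ₗ[ℝ] ℝ)) (y : V) : Prop :=
  y ≠ 0 ∧ ∀ w : V, (∀ f ∈ L, f y = 0 → f w = 0) → ∃ c : ℝ, w = c • y

lemma conf_decomp (L : Finset (V →ₗ[ℝ] ℝ)) (hess : ∀ y : V, (∀ f ∈ L, f y = 0) → y = 0)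
    (R : Finset V) (hR : ∀ y, Elem L y → ∃ r ∈ R, Conf L r y ∧ ∃ c : ℝ, 0 ≤ c ∧ y = c • r) :
    ∀ (n : ℕ) (y : V), nz L y ≤ n → ∃ c : V → ℝ, (∀ v, 0 ≤ c v) ∧
      (∀ v ∈ R, 0 < c v → Conf L v y) ∧ y = ∑ v ∈ R, c v • v := by
  intro n
  induction n with
  | zero =>
    intro y hy
    have : y = 0 := by
      apply hess
      intro f hf
      by_contra h
      have : f ∈ L.filter (fun f => f y ≠ 0) := by simp [hf, h]
      have h2 := Finset.card_pos.mpr ⟨f, this⟩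
      unfold nz at hy; omega
    exact ⟨0, by simp, by simp, by simp [this]⟩
  | succ n ih =>
    intro y hy
    by_cases hy0 : y = 0
    · exact ⟨0, by simp, by simp, by simp [hy0]⟩
    by_cases hE : Elem L y
    · obtain ⟨r, hr, hc, c, hc0, hyc⟩ := hR y hE
      refine ⟨fun v => if v = r then c else 0, ?_, ?_, ?_⟩
      · intro v; by_cases h : v = r <;> simp [h, hc0]
      · intro v hv h
        by_cases h' : v = r
        · rw [h']; exact hc
        · simp [h'] at h
      · rw [Finset.sum_eq_single r]
        · simp [hyc]
        · intro b _ hb; simp [hb]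
        · intro h; exact absurd hr h
    · simp only [Elem, not_and, not_forall] at hE
      obtain ⟨w, hw, hwy⟩ := hE hy0
      push Not at hwy
      -- adjust the sign of w
      have hwne : w ≠ 0 := fun h => hwy 0 (by simp [h])
      obtain ⟨f, hf, hfw⟩ : ∃ f ∈ L, f w ≠ 0 := by
        by_contra h; push Not at h; exact hwne (hess w h)
      have hfy : f y ≠ 0 := fun h => hfw (hw f hf h)
      obtain ⟨w', hw', hwy', hpos⟩ : ∃ w' : V, (∀ f ∈ L, f y = 0 → f w' = 0) ∧
          (∀ c : ℝ, w' ≠ c • y) ∧ 0 < f w' * f y := by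
        rcases lt_or_gt_of_ne (mul_ne_zero hfw hfy) with h | h
        · refine ⟨-w, fun f hf h => by simp [hw f hf h], fun c hc => hwy (-c) ?_, by
            simp; linarith⟩
          rw [neg_smul, ← hc, neg_neg]
        · exact ⟨w, hw, hwy, h⟩
      obtain ⟨t, ht, hconf, hnz⟩ := conf_step L y w' hw' ⟨f, hf, hpos⟩
      set y2 := y - t • w' with hy2
      have hy2ne : y2 ≠ 0 := by
        intro h
        apply hwy' t⁻¹
        rw [sub_eq_zero.mp (hy2.symm.trans h), smul_smul, inv_mul_cancel₀ ht.ne', one_smul]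
      obtain ⟨g, hg, hgy2⟩ : ∃ f ∈ L, f y2 ≠ 0 := by
        by_contra h; push Not at h; exact hy2ne (hess y2 h)
      have hz2 : ∀ f ∈ L, f y = 0 → f y2 = 0 := fun f hf h =>
        le_antisymm ((hconf f hf).2 h.le) ((hconf f hf).1 h.ge)
      have hpos2 : 0 < g y2 * g y := by
        rcases lt_trichotomy (g y) 0 with h | h | h
        · exact mul_pos_of_neg_of_neg (lt_of_le_of_ne ((hconf g hg).2 h.le) hgy2) h
        · exact absurd (hz2 g hg h) hgy2
        · exact mul_pos (lt_of_le_of_ne ((hconf g hg).1 h.le) hgy2.symm) h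
      obtain ⟨s, hs, hconf3, hnz3⟩ := conf_step L y y2 hz2 ⟨g, hg, hpos2⟩
      obtain ⟨c, hc0, hcc, hce⟩ := ih y2 (by omega)
      obtain ⟨d, hd0, hdc, hde⟩ := ih (y - s • y2) (by omega)
      refine ⟨fun v => d v + s * c v, fun v => add_nonneg (hd0 v) (mul_nonneg hs.le (hc0 v)), ?_, ?_⟩
      · intro v hv hpos
        by_cases h : 0 < d v
        · exact (hdc v hv h).trans hconf3
        · have : 0 < c v := by
            have := hc0 v
            by_contra hh
            have h1 : c v = 0 := le_antisymm (not_lt.mp hh) this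
            simp only [h1, mul_zero, add_zero] at hpos
            exact h hpos
          exact (hcc v hv this).trans hconf
      · simp only [add_smul, Finset.sum_add_distrib, ← hde, mul_smul, ← Finset.smul_sum, ← hce]
        simp

/-- Minkowski: a finite conformal generating set for an essential arrangement. -/
theorem exists_conf_gens (L : Finset (V →ₗ[ℝ] ℝ)) (hess : ∀ y : V, (∀ f ∈ L, f y = 0) → y = 0) :
    ∃ R : Finset V, 0 ∉ R ∧ ∀ y : V, ∃ c : V → ℝ, (∀ v, 0 ≤ c v) ∧
      (∀ v ∈ R, 0 < c v → Conf L v y) ∧ y = ∑ v ∈ R, c v • v := by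
  let sg : V → (L → SignType) := fun y f => SignType.sign (f.1 y)
  have : ∀ s : L → SignType, ∃ r : V, (∃ y, Elem L y ∧ sg y = s) → (Elem L r ∧ sg r = s) := by
    intro s
    by_cases h : ∃ y, Elem L y ∧ sg y = s
    · obtain ⟨y, hy⟩ := h; exact ⟨y, fun _ => hy⟩
    · exact ⟨0, fun h' => absurd h' h⟩
  choose ρ hρ using this
  let R := (Finset.univ.image ρ).filter (fun v => v ≠ 0)
  refine ⟨R, by simp [R], fun y => conf_decomp L hess R ?_ _ y le_rfl⟩
  intro y hy
  obtain ⟨h1, h2⟩ := hρ (sg y) ⟨y, hy, rfl⟩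
  have hs : ∀ f ∈ L, SignType.sign (f (ρ (sg y))) = SignType.sign (f y) := fun f hf =>
    congrFun h2 ⟨f, hf⟩
  refine ⟨ρ (sg y), ?_, ?_, ?_⟩
  · simp only [R, Finset.mem_filter, Finset.mem_image]
    exact ⟨⟨_, Finset.mem_univ _, rfl⟩, h1.1⟩
  · intro f hf
    have := hs f hf
    constructor
    · intro h
      rw [← sign_nonneg_iff] at h ⊢; rwa [this]
    · intro h
      rw [← sign_nonpos_iff] at h ⊢; rwa [this]
  · obtain ⟨c, hc⟩ := h1.2 y (fun f hf h => by
      have := hs f hf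
      rw [h, sign_zero, eq_comm, sign_eq_zero_iff] at this; exact this)
    refine ⟨c, ?_, hc⟩
    by_contra hneg
    push Not at hneg
    apply hy.1
    apply hess
    intro f hf
    have := hs f hf
    have hfc : f y = c * f (ρ (sg y)) := by
      conv_lhs => rw [hc]
      simp
    rw [hfc, sign_mul, sign_neg hneg] at this
    have h3 : SignType.sign (f (ρ (sg y))) = 0 := by
      generalize SignType.sign (f (ρ (sg y))) = q at this
      revert this; cases q <;> decide
    rw [sign_eq_zero_iff] at h3
    rw [hfc, h3, mul_zero]

end QC


namespace QC

/-! ### Regular triangulations -/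

/-- The regular simplicial complex of tight sets. -/
def TK {ι : Type} (r : ι → V) (ω : ι → ℝ) (S : Finset ι) : Prop :=
  ∃ p : V →ₗ[ℝ] ℝ, (∀ i, p (r i) ≤ ω i) ∧ ∀ i ∈ S, p (r i) = ω i

lemma TK.mono {ι : Type} {r : ι → V} {ω : ι → ℝ} {S T : Finset ι} (h : TK r ω T) (hST : S ⊆ T) :
    TK r ω S := by
  obtain ⟨p, h1, h2⟩ := h
  exact ⟨p, h1, fun i hi => h2 i (hST hi)⟩

lemma exists_dual_forms {ι : Type} (r : ι → V) (T : Finset ι)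
    (h : LinearIndepOn ℝ r (T : Set ι)) :
    ∃ l : ι → (V →ₗ[ℝ] ℝ), ∀ i ∈ T, ∀ j ∈ T, l i (r j) = if i = j then 1 else 0 := by
  have h' : LinearIndependent ℝ (fun i : (T : Set ι) => r i) := h
  obtain ⟨g, hg⟩ := LinearMap.exists_leftInverse_of_injective _
    (LinearMap.ker_eq_bot.mpr h')
  refine ⟨fun i => if hi : i ∈ T then (Finsupp.lapply (⟨i, hi⟩ : (T : Set ι))) ∘ₗ g else 0, ?_⟩
  intro i hi j hj
  have := LinearMap.congr_fun hg (Finsupp.single ⟨j, hj⟩ 1)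
  simp at this
  simp [hi, this, Finsupp.single_apply, eq_comm]

lemma span_eq_sum {ι : Type} (r : ι → V) (T : Finset ι) (l : ι → (V →ₗ[ℝ] ℝ))
    (hl : ∀ i ∈ T, ∀ j ∈ T, l i (r j) = if i = j then 1 else 0) (y : V)
    (hy : y ∈ Submodule.span ℝ (r '' (T : Set ι))) : y = ∑ i ∈ T, l i y • r i := by
  induction hy using Submodule.span_induction with
  | mem x hx =>
    obtain ⟨j, hj, rfl⟩ := hx
    rw [Finset.sum_congr rfl (fun i hi => by rw [hl i hi j hj])]
    simp at hj
    simp [hj]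
  | zero => simp
  | add x y _ _ hx hy =>
    simp only [map_add, add_smul, Finset.sum_add_distrib]
    rw [← hx, ← hy]
  | smul a x _ hx =>
    simp only [map_smul, smul_assoc, ← Finset.smul_sum]
    rw [← hx]

lemma sum_apply_dual {ι : Type} (r : ι → V) (T : Finset ι) (l : ι → (V →ₗ[ℝ] ℝ))
    (hl : ∀ i ∈ T, ∀ j ∈ T, l i (r j) = if i = j then 1 else 0) (c : ι → ℝ) (i : ι) (hi : i ∈ T) :
    l i (∑ j ∈ T, c j • r j) = c i := by
  rw [map_sum, Finset.sum_congr rfl (fun j hj => by rw [map_smul, hl i hi j hj])]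
  simp [hi]

lemma indep_subset {ι : Type} (r : ι → V) (S T : Finset ι)
    (h : LinearIndepOn ℝ r ((S ∪ T : Finset ι) : Set ι))
    (hs : ∀ i ∈ S, r i ∈ Submodule.span ℝ (r '' (T : Set ι))) : S ⊆ T := by
  intro i hi
  by_contra hiT
  have h2 : LinearIndepOn ℝ r ((insert i T : Finset ι) : Set ι) := by
    apply h.mono
    intro j hj
    simp at hj ⊢
    rcases hj with rfl | hj
    · exact Or.inl hi
    · exact Or.inr hj
  rw [Finset.coe_insert, linearIndepOn_insert (by simpa using hiT)] at h2
  exact h2.2 (hs i hi)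

lemma lp_step {ι : Type} [Fintype ι] (r : ι → V) (ω : ι → ℝ) (p d : V →ₗ[ℝ] ℝ) (hp : ∀ i, p (r i) ≤ ω i)
    (hd : ∃ i, 0 < d (r i)) (ht : ∀ i, p (r i) = ω i → d (r i) ≤ 0) :
    ∃ t : ℝ, 0 < t ∧ (∀ i, (p + t • d) (r i) ≤ ω i) ∧
      ∃ i, 0 < d (r i) ∧ (p + t • d) (r i) = ω i := by
  obtain ⟨i0, hi0⟩ := hd
  obtain ⟨i1, hi1, hmin⟩ := (Finset.univ.filter (fun i => 0 < d (r i))).exists_min_image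
    (fun i => (ω i - p (r i)) / d (r i)) ⟨i0, by simp [hi0]⟩
  simp only [Finset.mem_filter, Finset.mem_univ, true_and] at hi1 hmin
  have hpos : 0 < (ω i1 - p (r i1)) / d (r i1) := by
    apply div_pos _ hi1
    rw [sub_pos]
    apply lt_of_le_of_ne (hp i1)
    intro h
    exact absurd (ht i1 h) (not_le.mpr hi1)
  refine ⟨_, hpos, ?_, i1, hi1, ?_⟩
  · intro i
    by_cases hi : 0 < d (r i)
    · have := hmin i hi
      rw [le_div_iff₀ hi] at this
      simp only [LinearMap.add_apply, LinearMap.smul_apply, smul_eq_mul]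
      linarith
    · push Not at hi
      simp only [LinearMap.add_apply, LinearMap.smul_apply, smul_eq_mul]
      have := hp i
      nlinarith
  · simp only [LinearMap.add_apply, LinearMap.smul_apply, smul_eq_mul]
    field_simp; ring

/-- The cones over the complex cover the whole space. -/
lemma tk_cover {ι : Type} [Fintype ι] (r : ι → V) (ω : ι → ℝ) (hω : ∀ i, 0 ≤ ω i)
    (hind : ∀ S, TK r ω S → LinearIndepOn ℝ r (S : Set ι))
    (hpos : ∀ d : V →ₗ[ℝ] ℝ, d ≠ 0 → ∃ i, 0 < d (r i)) (y : V) :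
    ∃ T, TK r ω T ∧ ∃ c : ι → ℝ, (∀ i ∈ T, 0 ≤ c i) ∧ y = ∑ i ∈ T, c i • r i := by
  -- existence of a vertex
  have hex : ∃ S, TK r ω S ∧ Submodule.span ℝ (r '' (S : Set ι)) = ⊤ := by
    obtain ⟨S, hS, hmax⟩ := (Finset.univ.filter (fun S => TK r ω S)).exists_max_image
      Finset.card ⟨∅, by simp; exact ⟨0, by simpa using hω, by simp⟩⟩
    simp only [Finset.mem_filter, Finset.mem_univ, true_and] at hS hmax
    refine ⟨S, hS, ?_⟩
    by_contra hne
    obtain ⟨d, hd0, hd⟩ := Submodule.exists_le_ker_of_lt_top _ (lt_top_iff_ne_top.mpr hne)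
    have hdS : ∀ i ∈ S, d (r i) = 0 := fun i hi =>
      hd (Submodule.subset_span ⟨i, hi, rfl⟩)
    obtain ⟨p, hp, hpS⟩ := hS
    have htight : ∀ i, p (r i) = ω i → i ∈ S := by
      intro i hi
      by_contra hiS
      have := hmax (insert i S) ⟨p, hp, by
        intro j hj
        rw [Finset.mem_insert] at hj
        rcases hj with rfl | hj
        · exact hi
        · exact hpS j hj⟩
      rw [Finset.card_insert_of_notMem hiS] at this
      omega
    obtain ⟨t, ht, hfeas, i, hi, hti⟩ := lp_step r ω p d hp (hpos d hd0)
      (fun i hi => (hdS i (htight i hi)).le)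
    have hiS : i ∉ S := fun h => by rw [hdS i h] at hi; exact lt_irrefl _ hi
    have := hmax (insert i S) ⟨p + t • d, hfeas, by
      intro j hj
      rw [Finset.mem_insert] at hj
      rcases hj with rfl | hj
      · exact hti
      · simp [hdS j hj, hpS j hj]⟩
    rw [Finset.card_insert_of_notMem hiS] at this
    omega
  have hch : ∀ S : Finset ι, ∃ p : V →ₗ[ℝ] ℝ, TK r ω S →
      (∀ i, p (r i) ≤ ω i) ∧ ∀ i ∈ S, p (r i) = ω i := by
    intro S
    by_cases h : TK r ω S
    · obtain ⟨p, hp⟩ := h; exact ⟨p, fun _ => hp⟩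
    · exact ⟨0, fun h' => absurd h' h⟩
  choose P hP using hch
  obtain ⟨S0, hS0⟩ := hex
  obtain ⟨S, hS, hmax⟩ := (Finset.univ.filter (fun S : Finset ι => TK r ω S ∧
    Submodule.span ℝ (r '' (S : Set ι)) = ⊤)).exists_max_image
      (fun S => P S y) ⟨S0, by simpa using hS0⟩
  simp only [Finset.mem_filter, Finset.mem_univ, true_and] at hS hmax
  obtain ⟨hTK, hspan⟩ := hS
  obtain ⟨l, hl⟩ := exists_dual_forms r S (hind S hTK)
  have hsum : ∀ z, z = ∑ i ∈ S, l i z • r i := fun z =>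
    span_eq_sum r S l hl z (by rw [hspan]; trivial)
  refine ⟨S, hTK, fun i => l i y, ?_, hsum y⟩
  intro i hi
  by_contra hneg
  push Not at hneg
  obtain ⟨hp, hpS⟩ := hP S hTK
  have htight : ∀ j, P S (r j) = ω j → j ∈ S := by
    intro j hj
    have : ({j} : Finset ι) ⊆ S := by
      apply indep_subset r {j} S
      · apply hind
        refine ⟨P S, hp, ?_⟩
        intro k hk
        simp at hk
        rcases hk with rfl | hk
        · exact hj
        · exact hpS k hk
      · intro i _; rw [hspan]; trivial
    exact this (by simp)
  obtain ⟨t, ht, hfeas, k, hk, htk⟩ := lp_step r ω (P S) (-(l i)) hp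
    (by
      apply hpos
      intro h
      have := LinearMap.congr_fun h y
      simp at this; linarith)
    (by
      intro j hj
      have := hl i hi j (htight j hj)
      simp only [LinearMap.neg_apply, this]
      split_ifs <;> simp)
  have hTK' : TK r ω (insert k (S.erase i)) := by
    refine ⟨_, hfeas, ?_⟩
    intro j hj
    rw [Finset.mem_insert, Finset.mem_erase] at hj
    rcases hj with rfl | ⟨hji, hj⟩
    · exact htk
    · have := hl i hi j hj
      rw [if_neg (Ne.symm hji)] at this
      simp [this, hpS j hj]
  have hspan' : Submodule.span ℝ (r '' ((insert k (S.erase i) : Finset ι) : Set ι)) = ⊤ := by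
    rw [eq_top_iff, ← hspan, Submodule.span_le]
    rintro _ ⟨j, hj, rfl⟩
    have hmem : ∀ j ∈ S, j ≠ i →
        r j ∈ Submodule.span ℝ (r '' ((insert k (S.erase i) : Finset ι) : Set ι)) := by
      intro j hj hji
      apply Submodule.subset_span
      exact ⟨j, by simp [hj, hji], rfl⟩
    by_cases hji : j = i
    · subst hji
      have h1 := hsum (r k)
      rw [← Finset.add_sum_erase S _ hi] at h1
      have h2 : l j (r k) ≠ 0 := by
        intro h; simp [h] at hk
      have h3 : r j = (l j (r k))⁻¹ • (r k - ∑ x ∈ S.erase j, l x (r k) • r x) := by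
        have h1' : r k - ∑ x ∈ S.erase j, l x (r k) • r x = l j (r k) • r j :=
          sub_eq_of_eq_add h1
        rw [h1', smul_smul, inv_mul_cancel₀ h2, one_smul]
      rw [h3]
      apply Submodule.smul_mem
      apply Submodule.sub_mem
      · exact Submodule.subset_span ⟨k, by simp, rfl⟩
      · apply Submodule.sum_mem
        intro x hx
        rw [Finset.mem_erase] at hx
        exact Submodule.smul_mem _ _ (hmem x hx.2 hx.1)
    · exact hmem j hj hji
  have hle := hmax _ ⟨hTK', hspan'⟩
  have heq : P (insert k (S.erase i)) = P S + t • (-(l i)) := by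
    apply LinearMap.ext_on hspan'
    rintro _ ⟨j, hj, rfl⟩
    rw [(hP _ hTK').2 j hj]
    rw [Finset.mem_coe, Finset.mem_insert, Finset.mem_erase] at hj
    rcases hj with rfl | ⟨hji, hj⟩
    · exact htk.symm
    · have := hl i hi j hj
      rw [if_neg (Ne.symm hji)] at this
      simp [this, hpS j hj]
  rw [heq] at hle
  simp at hle
  nlinarith

end QC


namespace QC

/-! ### Existence of a regular refinement -/

lemma conf_sum_abs {ι : Type} [Fintype ι] (r : ι → V) (L : Finset (V →ₗ[ℝ] ℝ)) (y : V) (c : ι → ℝ)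
    (h0 : ∀ i, 0 ≤ c i) (h1 : ∀ i, 0 < c i → Conf L (r i) y) (h2 : y = ∑ i, c i • r i)
    (f : V →ₗ[ℝ] ℝ) (hf : f ∈ L) : ∑ i, c i * |f (r i)| = |f y| := by
  have e : f y = ∑ i, c i * f (r i) := by
    conv_lhs => rw [h2]
    simp [map_sum]
  rcases le_total 0 (f y) with h | h
  · rw [abs_of_nonneg h, e]
    apply Finset.sum_congr rfl
    intro i _
    rcases (h0 i).eq_or_lt with h' | h'
    · simp [← h']
    · rw [abs_of_nonneg ((h1 i h' f hf).1 h)]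
  · rw [abs_of_nonpos h, e, ← Finset.sum_neg_distrib]
    apply Finset.sum_congr rfl
    intro i _
    rcases (h0 i).eq_or_lt with h' | h'
    · simp [← h']
    · rw [abs_of_nonpos ((h1 i h' f hf).2 h)]; ring

lemma exists_omega {ι : Type} [Fintype ι] (r : ι → V) (L : Finset (V →ₗ[ℝ] ℝ))
    (hess : ∀ y : V, (∀ f ∈ L, f y = 0) → y = 0) (hr : ∀ i, r i ≠ 0)
    (hconf : ∀ y : V, ∃ c : ι → ℝ, (∀ i, 0 ≤ c i) ∧ (∀ i, 0 < c i → Conf L (r i) y) ∧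
      y = ∑ i, c i • r i) :
    ∃ ω : ι → ℝ, (∀ i, 0 ≤ ω i) ∧ (∀ S, TK r ω S → LinearIndepOn ℝ r (S : Set ι)) ∧
      (∀ S, TK r ω S → ∀ i ∈ S, ∀ j ∈ S, ∀ f ∈ L, 0 < f (r i) → f (r j) < 0 → False) := by
  choose c hc0 hc1 hc2 using hconf
  let g0 : ι → ℝ := fun i => ∑ f ∈ L, |f (r i)|
  have hg0 : ∀ i, 0 < g0 i := by
    intro i
    have : ∃ f ∈ L, f (r i) ≠ 0 := by
      by_contra h
      push Not at h
      exact hr i (hess _ h)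
    obtain ⟨f, hf, hfi⟩ := this
    exact Finset.sum_pos' (fun _ _ => abs_nonneg _) ⟨f, hf, abs_pos.mpr hfi⟩
  have hdep : ∀ S : Finset ι, ∃ a : ι → ℝ, ¬ LinearIndepOn ℝ r (S : Set ι) →
      a ≠ 0 ∧ (∀ i, i ∉ S → a i = 0) ∧ ∑ i, a i • r i = 0 := by
    intro S
    by_cases h : LinearIndepOn ℝ r (S : Set ι)
    · exact ⟨0, fun h' => absurd h h'⟩
    · have h' := h
      rw [linearIndepOn_finset_iff] at h'
      push Not at h'
      obtain ⟨g, hg, i, hi, hgi⟩ := h'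
      refine ⟨fun i => if i ∈ S then g i else 0, fun _ => ⟨?_, ?_, ?_⟩⟩
      · intro h0
        have := congrFun h0 i
        simp [hi] at this
        exact hgi this
      · intro i hi; simp [hi]
      · rw [← hg]; simp [ite_smul, Finset.sum_ite_mem]
  choose a ha using hdep
  obtain ⟨η, hη⟩ : ∃ η : ι → ℝ, ∀ S : Finset ι, ¬ LinearIndepOn ℝ r (S : Set ι) →
      ∑ i, a S i * η i ≠ 0 := by
    obtain ⟨d, hd⟩ := Module.exists_dual_forall_apply_ne_zero (K := ℝ) (M := ι → ℝ)
      (fun S : {S : Finset ι // ¬ LinearIndepOn ℝ r (S : Set ι)} => a S.1)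
      (fun S => (ha S.1 S.2).1)
    refine ⟨fun i => d (Pi.single i 1), fun S hS => ?_⟩
    have := hd ⟨S, hS⟩
    rw [← Finset.univ_sum_single (a S)] at this
    simp only [map_sum] at this
    convert this using 2 with i
    have : (Pi.single i (a S i) : ι → ℝ) = a S i • Pi.single i 1 := by
      rw [← Pi.single_smul]; simp
    rw [this, map_smul, smul_eq_mul]
  have E1 : ∀ i, ∀ᶠ ε in nhdsWithin (0 : ℝ) (Set.Ioi 0), 0 < g0 i + ε * η i := by
    intro i
    apply Filter.Eventually.filter_mono nhdsWithin_le_nhds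
    have : Continuous fun ε : ℝ => g0 i + ε * η i := by fun_prop
    have h := this.tendsto 0
    simp only [zero_mul, add_zero] at h
    exact h.eventually_const_lt (hg0 i)
  have E2 : ∀ S : Finset ι, ∀ᶠ ε in nhdsWithin (0 : ℝ) (Set.Ioi 0),
      ¬ LinearIndepOn ℝ r (S : Set ι) → ∑ i, a S i * (g0 i + ε * η i) ≠ 0 := by
    intro S
    by_cases hS : LinearIndepOn ℝ r (S : Set ι)
    · exact Filter.Eventually.of_forall (fun _ h => absurd hS h)
    have hb := hη S hS
    have e : ∀ ε : ℝ, ∑ i, a S i * (g0 i + ε * η i) =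
        ∑ i, a S i * g0 i + ε * ∑ i, a S i * η i := by
      intro ε
      rw [Finset.mul_sum, ← Finset.sum_add_distrib]
      exact Finset.sum_congr rfl fun i _ => by ring
    simp only [e]
    by_cases h0 : ∑ i, a S i * g0 i = 0
    · filter_upwards [self_mem_nhdsWithin] with ε hε _
      rw [h0, zero_add]
      exact mul_ne_zero (ne_of_gt hε) hb
    · apply Filter.Eventually.filter_mono nhdsWithin_le_nhds
      have : Continuous fun ε : ℝ => ∑ i, a S i * g0 i + ε * ∑ i, a S i * η i := by fun_prop
      have h := this.tendsto 0
      simp only [zero_mul, add_zero] at h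
      filter_upwards [h.eventually_ne h0] with ε hε _
      exact hε
  have E3 : ∀ q : ι × ι, ∀ᶠ ε in nhdsWithin (0 : ℝ) (Set.Ioi 0),
      (∃ f ∈ L, 0 < f (r q.1) ∧ f (r q.2) < 0) →
      ∑ k, c (r q.1 + r q.2) k * (g0 k + ε * η k) <
        (g0 q.1 + ε * η q.1) + (g0 q.2 + ε * η q.2) := by
    rintro ⟨i, j⟩
    by_cases hs : ∃ f ∈ L, 0 < f (r i) ∧ f (r j) < 0
    swap
    · exact Filter.Eventually.of_forall (fun _ h => absurd h hs)
    obtain ⟨f, hf, hfi, hfj⟩ := hs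
    have hlt : ∑ k, c (r i + r j) k * g0 k < g0 i + g0 j := by
      have : ∑ k, c (r i + r j) k * g0 k = ∑ f ∈ L, |f (r i + r j)| := by
        simp only [g0, Finset.mul_sum]
        rw [Finset.sum_comm]
        exact Finset.sum_congr rfl fun f hf =>
          conf_sum_abs r L _ _ (hc0 _) (hc1 _) (hc2 _) f hf
      rw [this, ← Finset.sum_add_distrib]
      apply Finset.sum_lt_sum
      · intro f _; rw [map_add]; exact abs_add_le _ _
      · refine ⟨f, hf, ?_⟩
        rw [map_add, abs_of_pos hfi, abs_of_neg hfj, abs_lt]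
        constructor <;> linarith
    apply Filter.Eventually.filter_mono nhdsWithin_le_nhds
    have h1 : Continuous fun ε : ℝ => ∑ k, c (r i + r j) k * (g0 k + ε * η k) := by fun_prop
    have h2 : Continuous fun ε : ℝ => (g0 i + ε * η i) + (g0 j + ε * η j) := by fun_prop
    have := (h1.tendsto 0).eventually_lt (h2.tendsto 0) (by simpa using hlt)
    filter_upwards [this] with ε hε _
    exact hε
  obtain ⟨ε, hε1, hε2, hε3⟩ := ((Filter.eventually_all.mpr E1).and
    ((Filter.eventually_all.mpr E2).and (Filter.eventually_all.mpr E3))).exists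
  refine ⟨fun i => g0 i + ε * η i, fun i => (hε1 i).le, ?_, ?_⟩
  · rintro S ⟨p, hp, hpS⟩
    by_contra hS
    obtain ⟨_, h1, h2⟩ := ha S hS
    apply hε2 S hS
    have : ∑ i, a S i * (g0 i + ε * η i) = p (∑ i, a S i • r i) := by
      rw [map_sum]
      apply Finset.sum_congr rfl
      intro i _
      by_cases hi : i ∈ S
      · rw [map_smul, hpS i hi, smul_eq_mul]
      · simp [h1 i hi]
    rw [this, h2, map_zero]
  · rintro S ⟨p, hp, hpS⟩ i hi j hj f hf h1 h2
    have h3 := hε3 (i, j) ⟨f, hf, h1, h2⟩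
    simp only at h3
    have h4 : p (r i + r j) = (g0 i + ε * η i) + (g0 j + ε * η j) := by
      rw [map_add, hpS i hi, hpS j hj]
    have h5 : p (r i + r j) = ∑ k, c (r i + r j) k * p (r k) := by
      conv_lhs => rw [hc2 (r i + r j)]
      simp [map_sum]
    have h6 : ∑ k, c (r i + r j) k * p (r k) ≤
        ∑ k, c (r i + r j) k * (g0 k + ε * η k) :=
      Finset.sum_le_sum fun k _ => mul_le_mul_of_nonneg_left (hp k) (hc0 _ k)
    linarith

/-! Basic facts on cones -/

lemma cone_zero (σ : Cone V) : (0 : V) ∈ σ.carrier := by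
  obtain ⟨s, hs⟩ := σ.isPoly
  rw [hs]; exact ⟨0, by simp, by simp⟩

lemma cone_add (σ : Cone V) {x y : V} (hx : x ∈ σ.carrier) (hy : y ∈ σ.carrier) :
    x + y ∈ σ.carrier := by
  obtain ⟨s, hs⟩ := σ.isPoly
  rw [hs] at hx hy ⊢
  obtain ⟨c, h1, rfl⟩ := hx
  obtain ⟨d, h2, rfl⟩ := hy
  exact ⟨c + d, fun v hv => add_nonneg (h1 v hv) (h2 v hv), by
    simp [add_smul, Finset.sum_add_distrib]⟩

lemma cone_smul (σ : Cone V) {x : V} {t : ℝ} (ht : 0 ≤ t) (hx : x ∈ σ.carrier) :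
    t • x ∈ σ.carrier := by
  obtain ⟨s, hs⟩ := σ.isPoly
  rw [hs] at hx ⊢
  obtain ⟨c, h1, rfl⟩ := hx
  exact ⟨t • c, fun v hv => mul_nonneg ht (h1 v hv), by
    simp [Finset.smul_sum, smul_smul]⟩

/-- A regular simplicial refinement of a complete fan. -/
structure Tri (Δ : Fan V) where
  ι : Type
  [ft : Fintype ι]
  r : ι → V
  ω : ι → ℝ
  ind : ∀ S, TK r ω S → LinearIndepOn ℝ r (S : Set ι)
  sub : ∀ S, TK r ω S → ∃ σ ∈ Δ.cones, ∀ i ∈ S, r i ∈ σ.carrier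
  cov : ∀ y, ∃ T, TK r ω T ∧ ∃ c : ι → ℝ, (∀ i ∈ T, 0 ≤ c i) ∧ y = ∑ i ∈ T, c i • r i

attribute [instance] Tri.ft

theorem exists_tri [FiniteDimensional ℝ V] (Δ : Fan V) (hΔ : Δ.IsComplete) : Nonempty (Tri Δ) := by
  have hW : ∀ σ : Cone V, ∃ L : Finset (V →ₗ[ℝ] ℝ), ∀ x, x ∈ σ.carrier ↔ ∀ f ∈ L, 0 ≤ f x := by
    intro σ
    obtain ⟨s, hs⟩ := σ.isPoly
    rw [hs]; exact weyl s
  choose W hW using hW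
  let b := Module.finBasis ℝ V
  let L : Finset (V →ₗ[ℝ] ℝ) := Δ.finite.toFinset.biUnion W ∪ Finset.univ.image (fun i => b.coord i)
  have hess : ∀ y : V, (∀ f ∈ L, f y = 0) → y = 0 := by
    intro y hy
    apply b.forall_coord_eq_zero_iff.mp
    intro i
    exact hy _ (by simp [L])
  obtain ⟨R, hR0, hR⟩ := exists_conf_gens L hess
  let r : R → V := fun i => i.1
  have hconf : ∀ y : V, ∃ c : R → ℝ, (∀ i, 0 ≤ c i) ∧ (∀ i, 0 < c i → Conf L (r i) y) ∧
      y = ∑ i, c i • r i := by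
    intro y
    obtain ⟨c, h0, h1, h2⟩ := hR y
    refine ⟨fun i => c i, fun i => h0 i, fun i hi => h1 i i.2 hi, ?_⟩
    conv_lhs => rw [h2]
    exact (Finset.sum_coe_sort R (fun v => c v • v)).symm
  obtain ⟨ω, hω, hind, hsep⟩ := exists_omega r L hess
    (fun i h => hR0 (by have := i.2; rwa [show (i : V) = 0 from h] at this)) hconf
  refine ⟨⟨R, r, ω, hind, ?_, ?_⟩⟩
  · intro S hS
    have hx : (∑ i ∈ S, r i) ∈ Δ.support := by rw [hΔ]; trivial
    simp only [Fan.support, Set.mem_iUnion] at hx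
    obtain ⟨σ, hσ, hx⟩ := hx
    refine ⟨σ, hσ, fun i hi => ?_⟩
    rw [hW]
    intro f hf
    by_contra hneg
    push Not at hneg
    have hfL : f ∈ L := by
      simp only [L, Finset.mem_union, Finset.mem_biUnion, Set.Finite.mem_toFinset]
      exact Or.inl ⟨σ, hσ, hf⟩
    have h1 : ∀ j ∈ S, f (r j) ≤ 0 := by
      intro j hj
      by_contra h
      push Not at h
      exact hsep S hS j hj i hi f hfL h hneg
    have h2 := (hW σ _).mp hx f hf
    rw [map_sum] at h2
    have : ∑ j ∈ S, f (r j) < 0 := Finset.sum_neg' h1 ⟨i, hi, hneg⟩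
    linarith
  · apply tk_cover r ω hω hind
    intro d hd
    by_contra h
    push Not at h
    apply hd
    have key : ∀ y, d y ≤ 0 := by
      intro y
      obtain ⟨c, h0, _, h2⟩ := hconf y
      rw [h2, map_sum]
      apply Finset.sum_nonpos
      intro i _
      rw [map_smul, smul_eq_mul]
      exact mul_nonpos_of_nonneg_of_nonpos (h0 i) (h i)
    ext y
    have h1 := key y
    have h2 := key (-y)
    rw [map_neg] at h2
    simp; linarith

/-- The cones of the refinement contained in a cone of the fan cover it. -/
lemma Tri.cov_cone {Δ : Fan V} (t : Tri Δ) (σ : Cone V) (hσ : σ ∈ Δ.cones) (y : V)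
    (hy : y ∈ σ.carrier) : ∃ T, TK t.r t.ω T ∧ (∀ i ∈ T, t.r i ∈ σ.carrier) ∧
      ∃ c : t.ι → ℝ, (∀ i ∈ T, 0 ≤ c i) ∧ y = ∑ i ∈ T, c i • t.r i := by
  obtain ⟨T, hT, c, hc, hyc⟩ := t.cov y
  let T' := T.filter (fun i => 0 < c i)
  have hT' : TK t.r t.ω T' := hT.mono (Finset.filter_subset _ _)
  have hyc' : y = ∑ i ∈ T', c i • t.r i := by
    rw [hyc]
    symm
    apply Finset.sum_subset (Finset.filter_subset _ _)
    intro i hi hi'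
    simp only [Finset.mem_filter, not_and, not_lt] at hi'
    rw [le_antisymm (hi' hi) (hc i hi), zero_smul]
  have hpos : ∀ i ∈ T', 0 < c i := fun i hi => (Finset.mem_filter.mp hi).2
  refine ⟨T', hT', ?_, c, fun i hi => (hpos i hi).le, hyc'⟩
  obtain ⟨σ', hσ', hTσ⟩ := t.sub T' hT'
  obtain ⟨τ, _, _, ⟨f, hf, hτf⟩, hτ⟩ := Δ.inter_mem σ hσ σ' hσ'
  have hyσ' : y ∈ σ'.carrier := by
    rw [hyc']
    apply Finset.sum_induction _ (fun x => x ∈ σ'.carrier) (fun _ _ => cone_add σ') (cone_zero σ')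
    intro i hi
    exact cone_smul σ' (hpos i hi).le (hTσ i hi)
  have hyτ : y ∈ τ.carrier := by rw [hτ]; exact ⟨hy, hyσ'⟩
  rw [hτf] at hyτ
  have hfy : f y = 0 := hyτ.2
  rw [hyc', map_sum] at hfy
  rw [Finset.sum_eq_zero_iff_of_nonneg (fun i hi => by
    rw [map_smul]; exact mul_nonneg (hpos i hi).le (hf _ (hTσ i hi)))] at hfy
  intro i hi
  have h1 := hfy i hi
  rw [map_smul, smul_eq_mul, mul_eq_zero] at h1
  have h2 : f (t.r i) = 0 := h1.resolve_left (hpos i hi).ne'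
  have h3 : t.r i ∈ τ.carrier := by rw [hτf]; exact ⟨hTσ i hi, h2⟩
  rw [hτ] at h3
  exact h3.1

end QC


namespace QC

/-! ### Line shellings of the refinement -/

/-- The subcomplex of the refinement supported in `C`. -/
def KC {ι : Type} (r : ι → V) (ω : ι → ℝ) (C : Set V) (S : Finset ι) : Prop :=
  TK r ω S ∧ ∀ i ∈ S, r i ∈ C

lemma KC.mono {ι : Type} {r : ι → V} {ω : ι → ℝ} {C : Set V} {S T : Finset ι} (h : KC r ω C T)
    (hST : S ⊆ T) : KC r ω C S := ⟨h.1.mono hST, fun i hi => h.2 i (hST hi)⟩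

lemma exists_generic (C : Set V) (h0 : (0 : V) ∈ C) (hadd : ∀ x ∈ C, ∀ y ∈ C, x + y ∈ C)
    (hsmul : ∀ t : ℝ, 0 ≤ t → ∀ x ∈ C, t • x ∈ C) (Ws : Finset (Submodule ℝ V))
    (hW : ∀ W ∈ Ws, ∃ c ∈ C, c ∉ W) : ∃ v ∈ C, ∀ W ∈ Ws, v ∉ W := by
  induction Ws using Finset.induction_on with
  | empty => exact ⟨0, h0, by simp⟩
  | insert W Ws _ ih =>
    obtain ⟨v, hv, hvW⟩ := ih (fun W hW' => hW W (Finset.mem_insert_of_mem hW'))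
    by_cases hvW' : v ∈ W
    swap
    · refine ⟨v, hv, ?_⟩
      intro W1 hW1
      rcases Finset.mem_insert.mp hW1 with rfl | h
      · exact hvW'
      · exact hvW _ h
    obtain ⟨c, hc, hcW⟩ := hW W (Finset.mem_insert_self _ _)
    have hfin : (⋃ W1 ∈ Ws, {t : ℝ | v + t • c ∈ W1}).Finite := by
      apply Set.Finite.biUnion (Finset.finite_toSet Ws)
      intro W1 hW1
      apply Set.Subsingleton.finite
      intro a ha b hb
      have ha' : v + a • c ∈ W1 := ha
      have hb' : v + b • c ∈ W1 := hb
      by_contra hab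
      have h1 := W1.sub_mem ha' hb'
      have h2 : (a - b) • c ∈ W1 := by
        convert h1 using 1; rw [sub_smul]; abel
      rw [W1.smul_mem_iff (sub_ne_zero.mpr hab)] at h2
      apply hvW W1 hW1
      have := W1.sub_mem ha' (W1.smul_mem a h2)
      simpa using this
    obtain ⟨t, ht, htn⟩ := (Set.Ioi_infinite (0 : ℝ)).exists_notMem_finite hfin
    have ht0 : 0 < t := ht
    refine ⟨v + t • c, hadd _ hv _ (hsmul t ht0.le c hc), ?_⟩
    intro W1 hW1 hmem
    rcases Finset.mem_insert.mp hW1 with rfl | h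
    · have := W1.sub_mem hmem hvW'
      rw [add_sub_cancel_left, W1.smul_mem_iff ht0.ne'] at this
      exact hcW this
    · exact htn (Set.mem_biUnion h hmem)

/-- Shelling data. -/
theorem shelling {ι : Type} [Fintype ι] (r : ι → V) (ω : ι → ℝ) (C : Set V)
    (h0 : (0 : V) ∈ C) (hadd : ∀ x ∈ C, ∀ y ∈ C, x + y ∈ C)
    (hsmul : ∀ t : ℝ, 0 ≤ t → ∀ x ∈ C, t • x ∈ C)
    (hind : ∀ S, TK r ω S → LinearIndepOn ℝ r (S : Set ι))
    (hcov : ∀ y ∈ C, ∃ T, TK r ω T ∧ (∀ i ∈ T, r i ∈ C) ∧ ∃ c : ι → ℝ, (∀ i ∈ T, 0 ≤ c i) ∧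
      y = ∑ i ∈ T, c i • r i) :
    ∃ (FF : Finset (Finset ι)) (I : Finset ι → Finset ι) (h : Finset ι → ℝ),
      (∀ T ∈ FF, KC r ω C T ∧ (∀ y ∈ C, y ∈ Submodule.span ℝ (r '' (T : Set ι))) ∧ I T ⊆ T) ∧
      (∀ S, KC r ω C S → ∃ T ∈ FF, I T ⊆ S ∧ S ⊆ T) ∧
      (∀ T ∈ FF, ∀ T' ∈ FF, ∀ S, I T ⊆ S → S ⊆ T → S ⊆ T' → T' ≠ T → h T' < h T) := by
  obtain ⟨v, hv, hgen⟩ := exists_generic C h0 hadd hsmul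
    ((Finset.univ.filter (fun T : Finset ι =>
      ∃ c ∈ C, c ∉ Submodule.span ℝ (r '' (T : Set ι)))).image
        (fun T : Finset ι => Submodule.span ℝ (r '' (T : Set ι)))) (by
      intro W hW
      simp only [Finset.mem_image, Finset.mem_filter, Finset.mem_univ, true_and] at hW
      obtain ⟨T, h1, rfl⟩ := hW
      exact h1)
  have hgen' : ∀ T : Finset ι, v ∈ Submodule.span ℝ (r '' (T : Set ι)) →
      ∀ c ∈ C, c ∈ Submodule.span ℝ (r '' (T : Set ι)) := by
    intro T hT c hc
    by_contra hcT
    refine hgen (Submodule.span ℝ (r '' (T : Set ι))) ?_ hT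
    simp only [Finset.mem_image, Finset.mem_filter, Finset.mem_univ, true_and]
    exact ⟨T, ⟨c, hc, hcT⟩, rfl⟩
  have hch : ∀ S : Finset ι, ∃ p : V →ₗ[ℝ] ℝ, TK r ω S →
      (∀ i, p (r i) ≤ ω i) ∧ ∀ i ∈ S, p (r i) = ω i := by
    intro S
    by_cases h : TK r ω S
    · obtain ⟨p, hp⟩ := h; exact ⟨p, fun _ => hp⟩
    · exact ⟨0, fun h' => absurd h' h⟩
  choose P hP using hch
  have hld : ∀ T : Finset ι, ∃ l : ι → (V →ₗ[ℝ] ℝ), TK r ω T →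
      ∀ i ∈ T, ∀ j ∈ T, l i (r j) = if i = j then 1 else 0 := by
    intro T
    by_cases h : TK r ω T
    · obtain ⟨l, hl⟩ := exists_dual_forms r T (hind T h)
      exact ⟨l, fun _ => hl⟩
    · exact ⟨0, fun h' => absurd h' h⟩
  choose l hl using hld
  have hne : ∀ T, KC r ω C T → (∀ y ∈ C, y ∈ Submodule.span ℝ (r '' (T : Set ι))) →
      ∀ i ∈ T, l T i v ≠ 0 := by
    intro T hT hsp i hi h
    have h1 := span_eq_sum r T (l T) (hl T hT.1) v (hsp v hv)
    rw [← Finset.add_sum_erase T _ hi, h, zero_smul, zero_add] at h1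
    have h2 : v ∈ Submodule.span ℝ (r '' ((T.erase i : Finset ι) : Set ι)) := by
      rw [h1]
      apply Submodule.sum_mem
      intro j hj
      exact Submodule.smul_mem _ _ (Submodule.subset_span ⟨j, hj, rfl⟩)
    have h3 := hgen' _ h2 (r i) (hT.2 i hi)
    have h4 := hind T hT.1
    rw [← Finset.insert_erase hi, Finset.coe_insert, linearIndepOn_insert (by simp)] at h4
    exact h4.2 h3
  refine ⟨Finset.univ.filter (fun T => KC r ω C T ∧
    ∀ y ∈ C, y ∈ Submodule.span ℝ (r '' (T : Set ι))),
    fun T => T.filter (fun i => l T i v < 0), fun T => P T v, ?_, ?_, ?_⟩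
  · intro T hT
    simp only [Finset.mem_filter, Finset.mem_univ, true_and] at hT
    exact ⟨hT.1, hT.2, Finset.filter_subset _ _⟩
  · intro S hS
    have hxC : ∑ i ∈ S, r i ∈ C := by
      apply Finset.sum_induction _ (fun x => x ∈ C) (fun a b ha hb => hadd a ha b hb) h0
      exact hS.2
    set x := ∑ i ∈ S, r i with hx
    have hm : ∀ m : ℕ, x + ((1 : ℝ) / (m + 1)) • v ∈ C := fun m =>
      hadd _ hxC _ (hsmul _ (by positivity) _ hv)
    choose Tm hTm1 hTm2 cm hcm hTm3 using fun m => hcov _ (hm m)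
    obtain ⟨T, hTinf⟩ := Finite.exists_infinite_fiber Tm
    rw [Set.infinite_coe_iff] at hTinf
    obtain ⟨m1, hm1⟩ := hTinf.nonempty
    have hKT : KC r ω C T := by
      have : Tm m1 = T := hm1
      rw [← this]; exact ⟨hTm1 m1, hTm2 m1⟩
    have hmemsp : ∀ m, Tm m = T →
        x + ((1 : ℝ) / (m + 1)) • v ∈ Submodule.span ℝ (r '' (T : Set ι)) := by
      intro m hmT
      rw [hTm3 m]
      apply Submodule.sum_mem
      intro j hj
      rw [hmT] at hj
      exact Submodule.smul_mem _ _ (Submodule.subset_span ⟨j, hj, rfl⟩)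
    obtain ⟨m2, hm2, hm12⟩ := hTinf.exists_gt m1
    have hvT : v ∈ Submodule.span ℝ (r '' (T : Set ι)) := by
      have h1 := Submodule.sub_mem _ (hmemsp m1 hm1) (hmemsp m2 hm2)
      have h2 : ((1 : ℝ) / (m1 + 1) - 1 / (m2 + 1)) • v ∈ Submodule.span ℝ (r '' (T : Set ι)) := by
        convert h1 using 1; rw [sub_smul]; abel
      rwa [Submodule.smul_mem_iff] at h2
      rw [sub_ne_zero]
      intro h
      have hlt : (1 : ℝ) / (m2 + 1) < 1 / (m1 + 1) := by
        apply one_div_lt_one_div_of_lt (by positivity)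
        exact_mod_cast Nat.succ_lt_succ hm12
      exact hlt.ne' h
    have hsp := hgen' T hvT
    have hlT := hl T hKT.1
    have hco : ∀ m, Tm m = T → ∀ i ∈ T, 0 ≤ l T i x + (1 / ((m : ℝ) + 1)) * l T i v := by
      intro m hmT i hi
      have h1 : l T i (x + ((1 : ℝ) / (m + 1)) • v) = cm m i := by
        rw [hTm3 m, hmT, sum_apply_dual r T (l T) hlT _ i hi]
      rw [map_add, map_smul, smul_eq_mul] at h1
      rw [h1]
      exact hcm m i (by rw [hmT]; exact hi)
    have hlx : ∀ i ∈ T, 0 ≤ l T i x := by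
      intro i hi
      by_contra hneg
      push Not at hneg
      obtain ⟨N, hN⟩ := exists_nat_gt (l T i v / (-(l T i x)))
      obtain ⟨m, hmT, hmN⟩ := hTinf.exists_gt N
      have h1 := hco m hmT i hi
      have hmN' : (N : ℝ) < m := by exact_mod_cast hmN
      rw [div_lt_iff₀ (by linarith)] at hN
      have h2 : 0 ≤ ((m : ℝ) + 1) * (l T i x + (1 / ((m : ℝ) + 1)) * l T i v) :=
        mul_nonneg (by positivity) h1
      have h3 : ((m : ℝ) + 1) * (l T i x + (1 / ((m : ℝ) + 1)) * l T i v) =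
        ((m : ℝ) + 1) * l T i x + l T i v := by field_simp
      rw [h3] at h2
      nlinarith
    have hxs := span_eq_sum r T (l T) hlT x (hsp x hxC)
    obtain ⟨hp1, hp2⟩ := hP T hKT.1
    obtain ⟨hq1, hq2⟩ := hP S hS.1
    have e1 : P T x = ∑ i ∈ S, P T (r i) := by rw [hx, map_sum]
    have e2 : P S x = ∑ i ∈ S, ω i := by
      rw [hx, map_sum]; exact Finset.sum_congr rfl hq2
    have e3 : P S x = ∑ i ∈ T, l T i x * P S (r i) := by
      conv_lhs => rw [hxs]
      simp [map_sum]
    have e4 : P T x = ∑ i ∈ T, l T i x * ω i := by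
      conv_lhs => rw [hxs]
      rw [map_sum]
      exact Finset.sum_congr rfl fun i hi => by rw [map_smul, hp2 i hi, smul_eq_mul]
    have e5 : P S x ≤ P T x := by
      rw [e3, e4]
      exact Finset.sum_le_sum fun i hi => mul_le_mul_of_nonneg_left (hq1 i) (hlx i hi)
    have e6 : ∑ i ∈ S, (ω i - P T (r i)) = 0 := by
      apply le_antisymm
      · rw [Finset.sum_sub_distrib, ← e1, ← e2]; linarith
      · exact Finset.sum_nonneg fun i _ => sub_nonneg.mpr (hp1 i)
    rw [Finset.sum_eq_zero_iff_of_nonneg fun i _ => sub_nonneg.mpr (hp1 i)] at e6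
    have hST : S ⊆ T := by
      apply indep_subset r S T
      · apply hind
        refine ⟨P T, hp1, fun i hi => ?_⟩
        rcases Finset.mem_union.mp hi with h | h
        · linarith [e6 i h]
        · exact hp2 i h
      · exact fun i hi => hsp _ (hS.2 i hi)
    refine ⟨T, by simpa using ⟨hKT, hsp⟩, ?_, hST⟩
    intro i hi
    rw [Finset.mem_filter] at hi
    by_contra hiS
    have h1 : l T i x = 0 := by
      rw [hx, map_sum]
      apply Finset.sum_eq_zero
      intro j hj
      rw [hlT i hi.1 j (hST hj), if_neg]
      rintro rfl; exact hiS hj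
    have h2 := hco m1 hm1 i hi.1
    rw [h1, zero_add] at h2
    have : (0 : ℝ) < 1 / (m1 + 1) := by positivity
    nlinarith [hi.2]
  · intro T hT T' hT' S hIS hST hST' hneq
    simp only [Finset.mem_filter, Finset.mem_univ, true_and] at hT hT'
    obtain ⟨hKT, hsp⟩ := hT
    obtain ⟨hKT', hsp'⟩ := hT'
    obtain ⟨hp1, hp2⟩ := hP T hKT.1
    obtain ⟨hq1, hq2⟩ := hP T' hKT'.1
    have hxs := span_eq_sum r T (l T) (hl T hKT.1) v (hsp v hv)
    have e : P T v - P T' v = ∑ i ∈ T, l T i v * (ω i - P T' (r i)) := by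
      conv_lhs => rw [hxs]
      rw [map_sum, map_sum, ← Finset.sum_sub_distrib]
      exact Finset.sum_congr rfl fun i hi => by
        rw [map_smul, map_smul, hp2 i hi, smul_eq_mul, smul_eq_mul]; ring
    have hnn : ∀ i ∈ T, 0 ≤ l T i v * (ω i - P T' (r i)) := by
      intro i hi
      by_cases h : l T i v < 0
      · rw [hq2 i (hST' (hIS (by simp [hi, h])))]; simp
      · push Not at h
        exact mul_nonneg h (sub_nonneg.mpr (hq1 i))
    rw [← sub_pos, e]
    apply lt_of_le_of_ne (Finset.sum_nonneg hnn)
    intro hz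
    rw [eq_comm, Finset.sum_eq_zero_iff_of_nonneg hnn] at hz
    have hU : TK r ω (T ∪ T') := by
      refine ⟨P T', hq1, fun i hi => ?_⟩
      rcases Finset.mem_union.mp hi with h | h
      · have := hz i h
        rw [mul_eq_zero] at this
        have := this.resolve_left (hne T hKT hsp i h)
        linarith
      · exact hq2 i h
    apply hneq
    apply Finset.Subset.antisymm
    · apply indep_subset r T' T (by rw [Finset.union_comm]; exact hind _ hU)
      exact fun i hi => hsp _ (hKT'.2 i hi)
    · apply indep_subset r T T' (hind _ hU)
      exact fun i hi => hsp' _ (hKT.2 i hi)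

end QC


namespace QC

/-! ### The polynomial ring -/

lemma polyAlg_lin (l : V →ₗ[ℝ] ℝ) : (fun x => l x) ∈ polyAlg V :=
  Algebra.subset_adjoin l.isLinear

/-- The polynomial function obtained by substituting linear forms. -/
def mkPoly {ι : Type} (l : ι → (V →ₗ[ℝ] ℝ)) (p : MvPolynomial ι ℝ) : PolyRing V :=
  ⟨fun y => MvPolynomial.eval (fun i => l i y) p, by
    induction p using MvPolynomial.induction_on with
    | C a =>
      simp only [MvPolynomial.eval_C]
      exact (polyAlg V).algebraMap_mem a
    | add p q hp hq =>
      simp only [map_add]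
      exact (polyAlg V).add_mem hp hq
    | mul_X p i hp =>
      simp only [map_mul, MvPolynomial.eval_X]
      exact (polyAlg V).mul_mem hp (polyAlg_lin (l i))⟩

@[simp] lemma mkPoly_apply {ι : Type} (l : ι → (V →ₗ[ℝ] ℝ)) (p : MvPolynomial ι ℝ) (y : V) :
    (mkPoly l p).1 y = MvPolynomial.eval (fun i => l i y) p := rfl

lemma exists_lift {ι : Type} [Fintype ι] (r : ι → V) (f : PolyRing V) :
    ∃ p : MvPolynomial ι ℝ, ∀ x, MvPolynomial.eval x p = f.1 (∑ i, x i • r i) := by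
  obtain ⟨f, hf⟩ := f
  induction hf using Algebra.adjoin_induction with
  | mem f hf =>
    let l : V →ₗ[ℝ] ℝ := hf.mk' f
    refine ⟨∑ i, MvPolynomial.C (l (r i)) * MvPolynomial.X i, fun x => ?_⟩
    change _ = l _
    simp [map_sum, mul_comm]
  | algebraMap a => exact ⟨MvPolynomial.C a, fun x => by simp⟩
  | add f g _ _ hf hg =>
    obtain ⟨p, hp⟩ := hf
    obtain ⟨q, hq⟩ := hg
    exact ⟨p + q, fun x => by simp [hp x, hq x]⟩
  | mul f g _ _ hf hg =>
    obtain ⟨p, hp⟩ := hf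
    obtain ⟨q, hq⟩ := hg
    exact ⟨p * q, fun x => by simp [hp x, hq x]⟩

/-- Pull back of polynomial functions along `x ↦ ∑ xᵢ rᵢ`. -/
def theta {ι : Type} [Fintype ι] (r : ι → V) : PolyRing V →+* MvPolynomial ι ℝ where
  toFun f := (exists_lift r f).choose
  map_one' := MvPolynomial.funext fun x => by
    rw [(exists_lift r 1).choose_spec]; simp
  map_mul' f g := MvPolynomial.funext fun x => by
    rw [(exists_lift r _).choose_spec, map_mul, (exists_lift r _).choose_spec,
      (exists_lift r _).choose_spec]; simp
  map_zero' := MvPolynomial.funext fun x => by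
    rw [(exists_lift r 0).choose_spec]; simp
  map_add' f g := MvPolynomial.funext fun x => by
    rw [(exists_lift r _).choose_spec, map_add, (exists_lift r _).choose_spec,
      (exists_lift r _).choose_spec]; simp

lemma eval_theta {ι : Type} [Fintype ι] (r : ι → V) (f : PolyRing V) (x : ι → ℝ) :
    MvPolynomial.eval x (theta r f) = f.1 (∑ i, x i • r i) := (exists_lift r f).choose_spec x

lemma polyRing_ext {f g : PolyRing V} (h : ∀ x, f.1 x = g.1 x) : f = g :=
  Subtype.ext (funext h)

lemma theta_basis_bijective {ι : Type} [Fintype ι] (b : Basis ι ℝ V) :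
    Function.Bijective (theta (fun i => b i)) := by
  constructor
  · intro f g h
    apply polyRing_ext
    intro x
    have h1 := eval_theta (fun i => b i) f (fun i => b.repr x i)
    have h2 := eval_theta (fun i => b i) g (fun i => b.repr x i)
    rw [b.sum_repr] at h1 h2
    rw [← h1, ← h2, h]
  · intro p
    refine ⟨mkPoly (fun i => b.coord i) p, ?_⟩
    apply MvPolynomial.funext
    intro x
    rw [eval_theta, mkPoly_apply]
    have : (fun i => b.coord i (∑ j, x j • b j)) = x := by
      funext i
      simp [map_sum, Finsupp.single_apply]
    rw [this]

def polyEquiv [FiniteDimensional ℝ V] :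
    PolyRing V ≃+* MvPolynomial (Fin (finrank ℝ V)) ℝ :=
  RingEquiv.ofBijective _ (theta_basis_bijective (Module.finBasis ℝ V))

instance polyNoeth [FiniteDimensional ℝ V] : IsNoetherianRing (PolyRing V) :=
  isNoetherianRing_of_ringEquiv _ (polyEquiv (V := V)).symm

instance polyDomain [FiniteDimensional ℝ V] : IsDomain (PolyRing V) :=
  Function.Injective.isDomain (polyEquiv (V := V)).toRingHom (polyEquiv (V := V)).injective

lemma mem_vanishing {s : Set V} {f : PolyRing V} :
    f ∈ vanishingIdeal V s ↔ ∀ x ∈ s, f.1 x = 0 := by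
  simp only [vanishingIdeal, RingHom.mem_ker]
  constructor
  · intro h x hx
    exact congrFun h ⟨x, hx⟩
  · intro h
    funext x
    exact h x.1 x.2

lemma mem_mId {f : PolyRing V} : f ∈ mId V ↔ f.1 0 = 0 := Iff.rfl

/-! ### Killing variables -/

def kill {ι : Type} (S : Finset ι) : MvPolynomial ι ℝ →ₐ[ℝ] MvPolynomial ι ℝ :=
  MvPolynomial.aeval (fun i => if i ∈ S then MvPolynomial.X i else 0)

lemma eval_kill {ι : Type} (S : Finset ι) (p : MvPolynomial ι ℝ) (x : ι → ℝ) :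
    MvPolynomial.eval x (kill S p) = MvPolynomial.eval (fun i => if i ∈ S then x i else 0) p := by
  induction p using MvPolynomial.induction_on with
  | C a => simp [kill]
  | add p q hp hq => simp [hp, hq]
  | mul_X p i hp =>
    rw [map_mul, map_mul, hp, map_mul]
    congr 1
    by_cases h : i ∈ S <;> simp [kill, h]

lemma kill_monomial {ι : Type} (S : Finset ι) (a : ι →₀ ℕ) (c : ℝ) :
    kill S (MvPolynomial.monomial a c) =
      if a.support ⊆ S then MvPolynomial.monomial a c else 0 := by
  rw [kill, MvPolynomial.aeval_monomial]
  split_ifs with h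
  · rw [MvPolynomial.monomial_eq]
    congr 1
    apply Finset.prod_congr rfl
    intro i hi
    simp only [if_pos (h hi)]
  · rw [Finset.not_subset] at h
    obtain ⟨i, hi, hiS⟩ := h
    rw [Finsupp.prod, Finset.prod_eq_zero hi, mul_zero]
    rw [if_neg hiS, zero_pow]
    simpa using hi

lemma coeff_kill {ι : Type} (S : Finset ι) (p : MvPolynomial ι ℝ) (a : ι →₀ ℕ) :
    MvPolynomial.coeff a (kill S p) = if a.support ⊆ S then MvPolynomial.coeff a p else 0 := by
  induction p using MvPolynomial.induction_on' with
  | monomial b c =>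
    rw [kill_monomial]
    by_cases hab : b = a
    · subst hab
      split_ifs <;> simp
    · split_ifs <;> simp [MvPolynomial.coeff_monomial, hab]
  | add p q hp hq =>
    rw [map_add, MvPolynomial.coeff_add, hp, hq, MvPolynomial.coeff_add]
    split_ifs <;> simp

lemma coeff_zero_of_eval {ι : Type} [Finite ι] (S : Finset ι) (p : MvPolynomial ι ℝ)
    (h : ∀ x : ι → ℝ, (∀ i, 0 ≤ x i) → MvPolynomial.eval (fun i => if i ∈ S then x i else 0) p = 0)
    (a : ι →₀ ℕ) (ha : a.support ⊆ S) : MvPolynomial.coeff a p = 0 := by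
  have h1 : kill S p = 0 := by
    apply MvPolynomial.funext_set (fun _ => Set.Ici (0 : ℝ)) (fun _ => Set.Ici_infinite 0)
    intro x hx
    rw [eval_kill, map_zero]
    exact h x (fun i => hx i trivial)
  have h2 := coeff_kill S p a
  rw [h1, if_pos ha] at h2
  simpa using h2.symm

lemma eval_zero_of_coeff {ι : Type} (S : Finset ι) (p : MvPolynomial ι ℝ)
    (h : ∀ a : ι →₀ ℕ, a.support ⊆ S → MvPolynomial.coeff a p = 0) (x : ι → ℝ) :
    MvPolynomial.eval (fun i => if i ∈ S then x i else 0) p = 0 := by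
  have h1 : kill S p = 0 := by
    ext a
    rw [coeff_kill]
    split_ifs with ha
    · simp [h a ha]
    · simp
  rw [← eval_kill, h1, map_zero]

/-! ### Stanley-Reisner modules -/

/-- The polynomial ring in the rays, as an `A`-module. -/
def PP {ι : Type} (_r : ι → V) : Type := MvPolynomial ι ℝ

instance {ι : Type} (r : ι → V) : CommRing (PP r) :=
  inferInstanceAs (CommRing (MvPolynomial ι ℝ))

instance {ι : Type} [Fintype ι] (r : ι → V) : Module (PolyRing V) (PP r) :=
  Module.compHom (MvPolynomial ι ℝ) (theta r)

def PP.co {ι : Type} {r : ι → V} (a : ι →₀ ℕ) (f : PP r) : ℝ :=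
  MvPolynomial.coeff (R := ℝ) (σ := ι) a f

lemma PP.smul_def {ι : Type} [Fintype ι] {r : ι → V} (a : PolyRing V) (f : PP r) :
    a • f = (theta r a * (show MvPolynomial ι ℝ from f) : MvPolynomial ι ℝ) := rfl

lemma PP.co_smul {ι : Type} [Fintype ι] {r : ι → V} (c : PolyRing V) (f : PP r) (a : ι →₀ ℕ) :
    PP.co a (c • f) = ∑ x ∈ Finset.HasAntidiagonal.antidiagonal a,
      MvPolynomial.coeff x.1 (theta r c) * PP.co x.2 f :=
  MvPolynomial.coeff_mul (R := ℝ) (σ := ι) (theta r c) f a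

lemma PP.co_add {ι : Type} {r : ι → V} (f g : PP r) (a : ι →₀ ℕ) :
    PP.co a (f + g) = PP.co a f + PP.co a g :=
  MvPolynomial.coeff_add (R := ℝ) (σ := ι) a f g

lemma PP.co_sub {ι : Type} {r : ι → V} (f g : PP r) (a : ι →₀ ℕ) :
    PP.co a (f - g) = PP.co a f - PP.co a g :=
  MvPolynomial.coeff_sub (R := ℝ) (σ := ι) a f g

/-- The ideal of polynomials all of whose monomials have support outside `K`. -/
def SRJ {ι : Type} [Fintype ι] (r : ι → V) (K : LowerSet (Finset ι)) :
    Submodule (PolyRing V) (PP r) where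
  carrier := {f | ∀ a : ι →₀ ℕ, a.support ∈ K → PP.co a f = 0}
  add_mem' := by
    intro f g hf hg a ha
    rw [PP.co_add, hf a ha, hg a ha, add_zero]
  zero_mem' := fun a _ => MvPolynomial.coeff_zero a
  smul_mem' := by
    intro c f hf a ha
    rw [PP.co_smul]
    apply Finset.sum_eq_zero
    rintro ⟨x, y⟩ hxy
    have hxy' : x + y = a := by simpa using hxy
    have : y.support ∈ K := by
      apply K.lower _ ha
      apply Finsupp.support_mono
      rw [← hxy']; exact le_add_self
    rw [hf y this, mul_zero]

lemma mem_SRJ {ι : Type} [Fintype ι] {r : ι → V} {K : LowerSet (Finset ι)} {f : PP r} :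
    f ∈ SRJ r K ↔ ∀ a : ι →₀ ℕ, a.support ∈ K → PP.co a f = 0 := Iff.rfl

/-- If `α` vanishes on `C` it annihilates the Stanley-Reisner module of complexes in `C`. -/
lemma SRJ_torsion {ι : Type} [Fintype ι] (r : ι → V) (K : LowerSet (Finset ι)) (C : Set V)
    (hC : ∀ S ∈ K, ∀ x : ι → ℝ, (∀ i, 0 ≤ x i) → ∑ i ∈ S, x i • r i ∈ C)
    (α : PolyRing V) (hα : α ∈ vanishingIdeal V C) (f : PP r) : α • f ∈ SRJ r K := by
  have h1 : ∀ a : ι →₀ ℕ, a.support ∈ K → MvPolynomial.coeff a (theta r α) = 0 := by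
    intro a ha
    apply coeff_zero_of_eval a.support _ _ a (le_refl _)
    intro x hx
    rw [eval_theta]
    apply mem_vanishing.mp hα
    have := hC _ ha x hx
    convert this using 1
    simp only [ite_smul, zero_smul, Finset.sum_ite_mem, Finset.univ_inter]
  intro a ha
  rw [PP.co_smul]
  apply Finset.sum_eq_zero
  rintro ⟨x, y⟩ hxy
  have hxy' : x + y = a := by simpa using hxy
  rw [h1 x, zero_mul]
  apply K.lower _ ha
  apply Finsupp.support_mono
  rw [← hxy']; exact le_self_add

end QC


namespace QC

/-! ### The lifting property -/

/-- `M` has the lifting property of projective `A/I`-modules. -/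
def LP (I : Ideal (PolyRing V)) (M : Type) [AddCommGroup M] [Module (PolyRing V) M] : Prop :=
  ∀ (N P : Type) [AddCommGroup N] [Module (PolyRing V) N] [AddCommGroup P] [Module (PolyRing V) P]
    (g : N →ₗ[PolyRing V] P), Function.Surjective g → (∀ a ∈ I, ∀ n : N, a • n = 0) →
    ∀ f : M →ₗ[PolyRing V] P, ∃ h : M →ₗ[PolyRing V] N, g ∘ₗ h = f

lemma exists_on_span {M N : Type} [AddCommGroup M] [Module (PolyRing V) M] [AddCommGroup N]
    [Module (PolyRing V) N] (m0 : M) (n0 : N) (h : ∀ a : PolyRing V, a • m0 = 0 → a • n0 = 0) :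
    ∃ u : LinearMap.range (LinearMap.toSpanSingleton (PolyRing V) M m0) →ₗ[PolyRing V] N,
      ∀ a : PolyRing V, ∀ hm : a • m0 ∈ LinearMap.range (LinearMap.toSpanSingleton (PolyRing V) M m0),
        u ⟨a • m0, hm⟩ = a • n0 := by
  let e := (LinearMap.toSpanSingleton (PolyRing V) M m0).quotKerEquivRange
  let w : (PolyRing V ⧸ LinearMap.ker (LinearMap.toSpanSingleton (PolyRing V) M m0))
      →ₗ[PolyRing V] N :=
    Submodule.liftQ _ (LinearMap.toSpanSingleton (PolyRing V) N n0) (by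
      intro a ha
      simp only [LinearMap.mem_ker, LinearMap.toSpanSingleton_apply] at ha ⊢
      exact h a ha)
  refine ⟨w ∘ₗ e.symm.toLinearMap, ?_⟩
  intro a hm
  have : e (Submodule.Quotient.mk a) = ⟨a • m0, hm⟩ := by
    apply Subtype.ext
    rfl
  rw [← this, LinearMap.comp_apply, LinearEquiv.coe_coe, LinearEquiv.symm_apply_apply]
  rfl

lemma LP.ext {I : Ideal (PolyRing V)} {M M'' : Type} [AddCommGroup M] [Module (PolyRing V) M]
    [AddCommGroup M''] [Module (PolyRing V) M''] (π : M →ₗ[PolyRing V] M'')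
    (hπ : Function.Surjective π) (hM'' : LP I M'') (htor : ∀ a ∈ I, ∀ m : M, a • m = 0)
    (m0 : M) (hker : ∀ m : M, π m = 0 ↔ ∃ a : PolyRing V, a • m0 = m)
    (hm0 : ∀ a : PolyRing V, a • m0 = 0 → a ∈ I) : LP I M := by
  intro N P _ _ _ _ g hg hN f
  obtain ⟨s, hs⟩ := hM'' M M'' π hπ htor LinearMap.id
  obtain ⟨h1, hh1⟩ := hM'' N P g hg hN (f ∘ₗ s)
  obtain ⟨n0, hn0⟩ := hg (f m0)
  obtain ⟨u, hu⟩ := exists_on_span m0 n0 (fun a ha => hN a (hm0 a ha) n0)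
  have hs' : ∀ x, π (s x) = x := fun x => LinearMap.congr_fun hs x
  have hmem : ∀ m, (LinearMap.id - s ∘ₗ π : M →ₗ[PolyRing V] M) m ∈
      LinearMap.range (LinearMap.toSpanSingleton (PolyRing V) M m0) := by
    intro m
    obtain ⟨a, ha⟩ := (hker ((LinearMap.id - s ∘ₗ π : M →ₗ[PolyRing V] M) m)).mp (by simp [hs'])
    exact ⟨a, by simpa using ha⟩
  refine ⟨h1 ∘ₗ π + u ∘ₗ LinearMap.codRestrict _ (LinearMap.id - s ∘ₗ π) hmem, ?_⟩
  ext m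
  have e1 : g (h1 (π m)) = f (s (π m)) := LinearMap.congr_fun hh1 (π m)
  obtain ⟨a, ha⟩ := hmem m
  rw [LinearMap.toSpanSingleton_apply] at ha
  have e2 : g (u (LinearMap.codRestrict _ (LinearMap.id - s ∘ₗ π) hmem m)) = f (m - s (π m)) := by
    have hx : (LinearMap.codRestrict _ (LinearMap.id - s ∘ₗ π) hmem m) =
        ⟨a • m0, by rw [ha]; exact hmem m⟩ := Subtype.ext ha.symm
    rw [hx, hu, map_smul, hn0, ← map_smul, ha]
    rfl
  simp only [LinearMap.comp_apply, LinearMap.add_apply, map_add]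
  rw [e1, e2, ← map_add]
  congr 1
  abel

lemma LP.of_subsingleton {I : Ideal (PolyRing V)} {M : Type} [AddCommGroup M]
    [Module (PolyRing V) M] [Subsingleton M] : LP I M := by
  intro N P _ _ _ _ g hg hN f
  refine ⟨0, ?_⟩
  ext m
  rw [Subsingleton.elim m 0]; simp

lemma LP.of_freeOverCone (σ : Cone V) {M : Type} [AddCommGroup M] [Module (PolyRing V) M]
    (h : FreeOverCone V σ M) : LP (vanishingIdeal V σ.carrier) M := by
  obtain ⟨ht, hfree⟩ := h
  intro N P _ _ _ _ g hg hN f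
  let _ := ht.module
  let b := Module.Free.chooseBasis (coneRing V σ) M
  have hN' : Module.IsTorsionBySet (PolyRing V) N (vanishingIdeal V σ.carrier) :=
    fun n a => hN a.1 a.2 n
  let _ := hN'.module
  choose n hn using fun i => hg (f (b i))
  let h' : M →ₗ[coneRing V σ] N := b.constr ℕ n
  have hsm : ∀ (a : PolyRing V) (m : M), a • m = (Ideal.Quotient.mk _ a : coneRing V σ) • m :=
    fun a m => rfl
  have hsn : ∀ (a : PolyRing V) (m : N), a • m = (Ideal.Quotient.mk _ a : coneRing V σ) • m :=
    fun a m => rfl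
  let h : M →ₗ[PolyRing V] N :=
    { toFun := h'
      map_add' := h'.map_add
      map_smul' := fun a m => by
        rw [hsm, h'.map_smul, RingHom.id_apply, hsn] }
  refine ⟨h, ?_⟩
  ext m
  have hm := b.mem_span m
  induction hm using Submodule.span_induction with
  | mem x hx =>
    obtain ⟨i, rfl⟩ := hx
    change g (h' (b i)) = _
    rw [Basis.constr_basis, hn]
  | zero => simp
  | add x y _ _ hx hy => rw [map_add, hx, hy, map_add]
  | smul a x _ hx =>
    obtain ⟨a, rfl⟩ := Ideal.Quotient.mk_surjective a
    rw [← hsm, map_smul, hx, map_smul]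

lemma projective_of_LP_bot {M : Type} [AddCommGroup M] [Module (PolyRing V) M]
    (h : LP (⊥ : Ideal (PolyRing V)) M) {N P : Type} [AddCommGroup N] [Module (PolyRing V) N]
    [AddCommGroup P] [Module (PolyRing V) P] (g : N →ₗ[PolyRing V] P) (hg : Function.Surjective g)
    (f : M →ₗ[PolyRing V] P) : ∃ k : M →ₗ[PolyRing V] N, g ∘ₗ k = f :=
  h N P g hg (by intro a ha n; rw [Ideal.mem_bot.mp ha, zero_smul]) f

/-- The square free monomial of a finite set, as an exponent. -/
def ind1 {ι : Type} (I : Finset ι) : ι →₀ ℕ := Finsupp.indicator I (fun _ _ => 1)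

lemma ind1_apply {ι : Type} (I : Finset ι) (i : ι) : ind1 I i = if i ∈ I then 1 else 0 := by
  simp [ind1, Finsupp.indicator_apply]

lemma ind1_support {ι : Type} (I : Finset ι) : (ind1 I).support = I := by
  ext i; simp [ind1_apply]

lemma ind1_le {ι : Type} (I : Finset ι) (a : ι →₀ ℕ) (h : I ⊆ a.support) : ind1 I ≤ a := by
  intro i
  rw [ind1_apply]
  split_ifs with hi
  · have := h hi
    rw [Finsupp.mem_support_iff] at this
    omega
  · exact Nat.zero_le _

/-- One step of the shelling argument. -/
lemma LP.step {ι : Type} [Fintype ι] (r : ι → V) (C : Set V) (K K' : LowerSet (Finset ι))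
    (I T : Finset ι) (hIT : I ⊆ T) (hKK' : ∀ S, S ∈ K ↔ S ∈ K' ∨ (I ⊆ S ∧ S ⊆ T))
    (hdisj : ∀ S, I ⊆ S → S ⊆ T → S ∉ K')
    (hlin : LinearIndepOn ℝ r (T : Set ι))
    (hspan : ∀ y ∈ C, y ∈ Submodule.span ℝ (r '' (T : Set ι)))
    (hC : ∀ S ∈ K, ∀ x : ι → ℝ, (∀ i, 0 ≤ x i) → ∑ i ∈ S, x i • r i ∈ C)
    (h : LP (vanishingIdeal V C) (PP r ⧸ SRJ r K')) :
    LP (vanishingIdeal V C) (PP r ⧸ SRJ r K) := by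
  have hle : SRJ r K ≤ SRJ r K' := fun f hf a ha => hf a ((hKK' _).mpr (Or.inl ha))
  let x0 : PP r := (MvPolynomial.monomial (ind1 I) (1 : ℝ) : MvPolynomial ι ℝ)
  have hx0 : x0 ∈ SRJ r K' := by
    intro a ha
    change MvPolynomial.coeff a (MvPolynomial.monomial (ind1 I) (1 : ℝ)) = 0
    rw [MvPolynomial.coeff_monomial, if_neg]
    rintro rfl
    rw [ind1_support] at ha
    exact hdisj I (le_refl _) hIT ha
  have hco : ∀ (α : PolyRing V) (b : ι →₀ ℕ),
      PP.co (b + ind1 I) (α • x0) = MvPolynomial.coeff b (theta r α) := by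
    intro α b
    change MvPolynomial.coeff (b + ind1 I)
      (theta r α * (MvPolynomial.monomial (ind1 I) (1 : ℝ))) = _
    rw [MvPolynomial.coeff_mul_monomial, mul_one]
  have hKT : ∀ b : ι →₀ ℕ, b.support ⊆ T → I ⊆ (b + ind1 I).support ∧
      (b + ind1 I).support ⊆ T := by
    intro b hb
    constructor
    · intro i hi
      simp [ind1_apply, hi]
    · refine Finsupp.support_add.trans (Finset.union_subset hb ?_)
      rw [ind1_support]; exact hIT
  obtain ⟨l, hl⟩ := exists_dual_forms r T hlin
  apply LP.ext (Submodule.factor hle) (Submodule.factor_surjective hle) h ?_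
    (Submodule.Quotient.mk x0) ?_ ?_
  · intro a ha m
    obtain ⟨f, rfl⟩ := Submodule.Quotient.mk_surjective _ m
    rw [← Submodule.Quotient.mk_smul, Submodule.Quotient.mk_eq_zero]
    exact SRJ_torsion r K C hC a ha f
  · intro m
    obtain ⟨f, rfl⟩ := Submodule.Quotient.mk_surjective _ m
    constructor
    · intro hf
      have hf : f ∈ SRJ r K' := by
        rw [← Submodule.Quotient.mk_eq_zero]; exact hf
      let q : MvPolynomial ι ℝ := MvPolynomial.divMonomial (show MvPolynomial ι ℝ from f) (ind1 I)
      let α : PolyRing V := mkPoly (fun i => if i ∈ T then l i else 0) q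
      have hαq : ∀ b : ι →₀ ℕ, b.support ⊆ T →
          MvPolynomial.coeff b (theta r α - q) = 0 := by
        intro b hb
        apply coeff_zero_of_eval T _ _ b hb
        intro x _
        rw [map_sub, eval_theta, mkPoly_apply, sub_eq_zero]
        have e1 : ∑ i, (if i ∈ T then x i else 0) • r i = ∑ i ∈ T, x i • r i := by
          simp only [ite_smul, zero_smul, Finset.sum_ite_mem, Finset.univ_inter]
        rw [e1]
        congr 2
        funext i
        by_cases hi : i ∈ T
        · simp only [if_pos hi]
          exact sum_apply_dual r T l hl x i hi
        · simp [hi]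
      refine ⟨α, ?_⟩
      rw [← Submodule.Quotient.mk_smul, Submodule.Quotient.eq]
      intro a ha
      rcases (hKK' _).mp ha with h1 | ⟨h1, h2⟩
      · exact (SRJ r K').sub_mem ((SRJ r K').smul_mem α hx0) hf a h1
      · obtain ⟨b, rfl⟩ : ∃ b, a = b + ind1 I :=
          ⟨a - ind1 I, (tsub_add_cancel_of_le (ind1_le I a h1)).symm⟩
        have hb : b.support ⊆ T := (Finsupp.support_mono le_self_add).trans h2
        have h3 := hαq b hb
        rw [MvPolynomial.coeff_sub, sub_eq_zero] at h3
        rw [PP.co_sub, hco, h3, sub_eq_zero]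
        rw [MvPolynomial.coeff_divMonomial, add_comm]
        rfl
    · rintro ⟨a, ha⟩
      rw [← ha, ← Submodule.Quotient.mk_smul]
      change Submodule.Quotient.mk (a • x0) = (0 : PP r ⧸ SRJ r K')
      rw [Submodule.Quotient.mk_eq_zero]
      exact Submodule.smul_mem _ _ hx0
  · intro α hα
    rw [← Submodule.Quotient.mk_smul, Submodule.Quotient.mk_eq_zero] at hα
    have h1 : ∀ b : ι →₀ ℕ, b.support ⊆ T → MvPolynomial.coeff b (theta r α) = 0 := by
      intro b hb
      rw [← hco]
      exact hα _ ((hKK' _).mpr (Or.inr (hKT b hb)))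
    rw [mem_vanishing]
    intro y hy
    have h2 := eval_zero_of_coeff T _ h1 (fun i => l i y)
    rw [eval_theta] at h2
    rw [span_eq_sum r T l hl y (hspan y hy)]
    convert h2 using 2
    simp only [ite_smul, zero_smul, Finset.sum_ite_mem, Finset.univ_inter]

/-- The complex of the refinement supported in `C`, as a lower set. -/
def KCl {ι : Type} (r : ι → V) (ω : ι → ℝ) (C : Set V) : LowerSet (Finset ι) :=
  ⟨{S | KC r ω C S}, fun _ _ hST hS => KC.mono hS hST⟩

lemma mem_KCl {ι : Type} {r : ι → V} {ω : ι → ℝ} {C : Set V} {S : Finset ι} :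
    S ∈ KCl r ω C ↔ KC r ω C S := Iff.rfl

/-- The Stanley-Reisner module of a cone is projective over its coordinate ring. -/
theorem LP_SR {ι : Type} [Fintype ι] (r : ι → V) (ω : ι → ℝ) (C : Set V)
    (h0 : (0 : V) ∈ C) (hadd : ∀ x ∈ C, ∀ y ∈ C, x + y ∈ C)
    (hsmul : ∀ t : ℝ, 0 ≤ t → ∀ x ∈ C, t • x ∈ C)
    (hind : ∀ S, TK r ω S → LinearIndepOn ℝ r (S : Set ι))
    (hcov : ∀ y ∈ C, ∃ T, TK r ω T ∧ (∀ i ∈ T, r i ∈ C) ∧ ∃ c : ι → ℝ, (∀ i ∈ T, 0 ≤ c i) ∧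
      y = ∑ i ∈ T, c i • r i) :
    LP (vanishingIdeal V C) (PP r ⧸ SRJ r (KCl r ω C)) := by
  obtain ⟨FF, I, h, hF, hb, hc⟩ := shelling r ω C h0 hadd hsmul hind hcov
  have hCK : ∀ S, KC r ω C S → ∀ x : ι → ℝ, (∀ i, 0 ≤ x i) → ∑ i ∈ S, x i • r i ∈ C := by
    intro S hS x hx
    apply Finset.sum_induction _ (fun x => x ∈ C) (fun a b ha hb => hadd a ha b hb) h0
    exact fun i hi => hsmul _ (hx i) _ (hS.2 i hi)
  have huniq : ∀ T ∈ FF, ∀ T' ∈ FF, ∀ S, I T ⊆ S → S ⊆ T → I T' ⊆ S → S ⊆ T' → T = T' := by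
    intro T hT T' hT' S h1 h2 h3 h4
    by_contra hne
    have a1 := hc T hT T' hT' S h1 h2 h4 (Ne.symm hne)
    have a2 := hc T' hT' T hT S h3 h4 h2 hne
    linarith
  have main : ∀ n : ℕ, ∀ U : Finset (Finset ι), U.card = n → U ⊆ FF →
      (∀ T ∈ U, ∀ T' ∈ FF, h T < h T' → T' ∈ U) → ∀ K : LowerSet (Finset ι),
      (∀ S, S ∈ K ↔ ∃ T ∈ U, I T ⊆ S ∧ S ⊆ T) →
      LP (vanishingIdeal V C) (PP r ⧸ SRJ r K) := by
    intro n
    induction n with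
    | zero =>
      intro U hU _ _ K hK
      rw [Finset.card_eq_zero] at hU
      subst hU
      have : SRJ r K = ⊤ := by
        rw [eq_top_iff]
        intro f _ a ha
        have := (hK _).mp ha
        simp at this
      rw [this]
      exact LP.of_subsingleton
    | succ n ih =>
      intro U hU hUF hup K hK
      obtain ⟨T, hT, hmin⟩ := U.exists_min_image h (by
        rw [← Finset.card_pos, hU]; omega)
      have hTF := hUF hT
      have hup' : ∀ T1 ∈ U.erase T, ∀ T' ∈ FF, h T1 < h T' → T' ∈ U.erase T := by
        intro T1 hT1 T' hT' hlt
        rw [Finset.mem_erase] at hT1 ⊢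
        refine ⟨?_, hup T1 hT1.2 T' hT' hlt⟩
        rintro rfl
        exact absurd (hmin T1 hT1.2) (not_le.mpr hlt)
      let K' : LowerSet (Finset ι) := ⟨{S | ∃ T' ∈ U.erase T, I T' ⊆ S ∧ S ⊆ T'}, by
        rintro S' S hSS' ⟨T', hT', h1, h2⟩
        have hT'F := hUF (Finset.mem_of_mem_erase hT')
        have hSS'' : S ⊆ S' := hSS'
        obtain ⟨T1, hT1, h3, h4⟩ := hb S ((hF T' hT'F).1.mono (hSS''.trans h2))
        by_cases he : T' = T1
        · subst he; exact ⟨T', hT', h3, h4⟩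
        · exact ⟨T1, hup' T' hT' T1 hT1 (hc T1 hT1 T' hT'F S h3 h4 (hSS''.trans h2) he), h3, h4⟩⟩
      have hmemK' : ∀ S, S ∈ K' ↔ ∃ T' ∈ U.erase T, I T' ⊆ S ∧ S ⊆ T' := fun S => Iff.rfl
      apply LP.step r C K K' (I T) T (hF T hTF).2.2
      · intro S
        rw [hK, hmemK']
        constructor
        · rintro ⟨T', hT', h1⟩
          by_cases he : T' = T
          · subst he; exact Or.inr h1
          · exact Or.inl ⟨T', Finset.mem_erase.mpr ⟨he, hT'⟩, h1⟩
        · rintro (⟨T', hT', h1⟩ | h1)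
          · exact ⟨T', Finset.mem_of_mem_erase hT', h1⟩
          · exact ⟨T, hT, h1⟩
      · intro S h1 h2 h3
        obtain ⟨T', hT', h4, h5⟩ := (hmemK' S).mp h3
        rw [Finset.mem_erase] at hT'
        exact hT'.1 (huniq T' (hUF hT'.2) T hTF S h4 h5 h1 h2)
      · exact hind T (hF T hTF).1.1
      · exact (hF T hTF).2.1
      · intro S hS
        obtain ⟨T', hT', _, h2⟩ := (hK S).mp hS
        exact hCK S ((hF T' (hUF hT')).1.mono h2)
      · exact ih (U.erase T) (by rw [Finset.card_erase_of_mem hT, hU]; rfl)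
          ((Finset.erase_subset _ _).trans hUF) hup' K' hmemK'
  apply main FF.card FF rfl (le_refl _) (fun _ _ T' hT' _ => hT')
  intro S
  rw [mem_KCl]
  constructor
  · exact hb S
  · rintro ⟨T, hT, _, h2⟩
    exact (hF T hT).1.mono h2

end QC


namespace QC

/-! ### The pure sheaf of the refinement -/

lemma Cone.ext' {σ τ : Cone V} (h : σ.carrier = τ.carrier) : σ = τ := by
  cases σ; cases τ; simp only at h; subst h; rfl

lemma face_subset {σ τ : Cone V} (h : τ.IsFaceOf σ) : τ.carrier ⊆ σ.carrier := by
  obtain ⟨f, _, hf⟩ := h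
  rw [hf]; exact Set.inter_subset_left

lemma face_refl (σ : Cone V) : σ.IsFaceOf σ := ⟨0, by simp, by simp⟩

abbrev BB {Δ : Fan V} (t : Tri Δ) (C : Set V) : Type := PP t.r ⧸ SRJ t.r (KCl t.r t.ω C)

lemma SRJ_anti {Δ : Fan V} (t : Tri Δ) {C C' : Set V} (h : C' ⊆ C) :
    SRJ t.r (KCl t.r t.ω C) ≤ SRJ t.r (KCl t.r t.ω C') :=
  fun _ hf a ha => hf a ⟨ha.1, fun i hi => h (ha.2 i hi)⟩

def bres {Δ : Fan V} (t : Tri Δ) {C C' : Set V} (h : C' ⊆ C) :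
    BB t C →ₗ[PolyRing V] BB t C' := Submodule.factor (SRJ_anti t h)

lemma bres_mk {Δ : Fan V} (t : Tri Δ) {C C' : Set V} (h : C' ⊆ C) (f : PP t.r) :
    bres t h (Submodule.Quotient.mk f) = Submodule.Quotient.mk f := rfl

lemma LP_BB_cone {Δ : Fan V} (t : Tri Δ) (σ : Δ.cones) :
    LP (vanishingIdeal V σ.1.carrier) (BB t σ.1.carrier) := by
  apply LP_SR t.r t.ω σ.1.carrier (cone_zero _) (fun x hx y hy => cone_add _ hx hy)
    (fun t ht x hx => cone_smul _ ht hx) t.ind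
  intro y hy
  exact t.cov_cone σ.1 σ.2 y hy

lemma LP_BB_univ {Δ : Fan V} (t : Tri Δ) : LP (⊥ : Ideal (PolyRing V)) (BB t Set.univ) := by
  have h := LP_SR t.r t.ω Set.univ trivial (fun _ _ _ _ => trivial)
    (fun _ _ _ _ => trivial) t.ind (by
      intro y _
      obtain ⟨T, h1, h2⟩ := t.cov y
      exact ⟨T, h1, fun _ _ => trivial, h2⟩)
  have e : vanishingIdeal V (Set.univ : Set V) = ⊥ := by
    rw [eq_bot_iff]
    intro f hf
    rw [mem_vanishing] at hf
    exact polyRing_ext fun x => hf x trivial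
  rwa [e] at h

lemma BB_torsion {Δ : Fan V} (t : Tri Δ) (σ : Cone V) :
    ∀ a ∈ vanishingIdeal V σ.carrier, ∀ m : BB t σ.carrier, a • m = 0 := by
  intro a ha m
  obtain ⟨f, rfl⟩ := Submodule.Quotient.mk_surjective _ m
  rw [← Submodule.Quotient.mk_smul, Submodule.Quotient.mk_eq_zero]
  apply SRJ_torsion t.r _ σ.carrier _ a ha f
  intro S hS x hx
  apply Finset.sum_induction _ (fun x => x ∈ σ.carrier) (fun a b => cone_add σ) (cone_zero σ)
  exact fun i hi => cone_smul σ (hx i) (hS.2 i hi)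

lemma BB_glue {Δ : Fan V} (t : Tri Δ) (Λ : Set (Cone V))
    (hinter : ∀ σ σ' : Δ.cones, σ.1 ∈ Λ → σ'.1 ∈ Λ → ∃ υ : Δ.cones, υ.1 ∈ Λ ∧
      υ.1.IsFaceOf σ.1 ∧ υ.1.IsFaceOf σ'.1 ∧ υ.1.carrier = σ.1.carrier ∩ σ'.1.carrier)
    (x : ∀ τ : Δ.cones, τ.1 ∈ Λ → BB t τ.1.carrier)
    (hx : ∀ (σ τ : Δ.cones) (hσ : σ.1 ∈ Λ) (hτ : τ.1 ∈ Λ) (h : τ.1.IsFaceOf σ.1),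
      bres t (face_subset h) (x σ hσ) = x τ hτ) :
    ∃ f : PP t.r, ∀ (τ : Δ.cones) (hτ : τ.1 ∈ Λ), Submodule.Quotient.mk f = x τ hτ := by
  have hrep : ∀ τ : Δ.cones, ∃ f : PP t.r, ∀ hτ : τ.1 ∈ Λ, Submodule.Quotient.mk f = x τ hτ := by
    intro τ
    by_cases hτ : τ.1 ∈ Λ
    · obtain ⟨f, hf⟩ := Submodule.Quotient.mk_surjective _ (x τ hτ)
      exact ⟨f, fun _ => hf⟩
    · exact ⟨0, fun h => absurd h hτ⟩
  choose g hg using hrep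
  have hco : ∀ (σ τ : Δ.cones), σ.1 ∈ Λ → τ.1 ∈ Λ → τ.1.IsFaceOf σ.1 → ∀ a : t.ι →₀ ℕ,
      KC t.r t.ω τ.1.carrier a.support → PP.co a (g σ) = PP.co a (g τ) := by
    intro σ τ hσ hτ h a ha
    have h1 := hx σ τ hσ hτ h
    rw [← hg σ hσ, ← hg τ hτ, bres_mk, Submodule.Quotient.eq] at h1
    have h2 := h1 a ha
    rwa [PP.co_sub, sub_eq_zero] at h2
  have hco2 : ∀ (σ τ : Δ.cones), σ.1 ∈ Λ → τ.1 ∈ Λ → ∀ a : t.ι →₀ ℕ,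
      KC t.r t.ω σ.1.carrier a.support →
      KC t.r t.ω τ.1.carrier a.support → PP.co a (g σ) = PP.co a (g τ) := by
    intro σ τ hσ hτ a h1 h2
    obtain ⟨υ, hυ, hf1, hf2, hc⟩ := hinter σ τ hσ hτ
    have h3 : KC t.r t.ω υ.1.carrier a.support :=
      ⟨h1.1, fun i hi => by rw [hc]; exact ⟨h1.2 i hi, h2.2 i hi⟩⟩
    rw [hco σ υ hσ hυ hf1 a h3, hco τ υ hτ hυ hf2 a h3]
  have : Fintype Δ.cones := Δ.finite.fintype
  let A : Finset (t.ι →₀ ℕ) := Finset.univ.biUnion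
    (fun τ : Δ.cones => MvPolynomial.support (show MvPolynomial t.ι ℝ from g τ))
  have hA : ∀ a, a ∉ A → ∀ τ, PP.co a (g τ) = 0 := by
    intro a ha τ
    by_contra h
    apply ha
    simp only [A, Finset.mem_biUnion, Finset.mem_univ, true_and]
    exact ⟨τ, MvPolynomial.mem_support_iff.mpr h⟩
  let co : (t.ι →₀ ℕ) → ℝ := fun a =>
    if h : ∃ τ : Δ.cones, τ.1 ∈ Λ ∧ KC t.r t.ω τ.1.carrier a.support then PP.co a (g h.choose) else 0
  let f : MvPolynomial t.ι ℝ := ∑ a ∈ A, MvPolynomial.monomial a (co a)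
  have hf : ∀ a, MvPolynomial.coeff a f = if a ∈ A then co a else 0 := by
    intro a
    simp only [f, MvPolynomial.coeff_sum, MvPolynomial.coeff_monomial]
    simp
  refine ⟨(show PP t.r from f), ?_⟩
  intro τ hτ
  rw [← hg τ hτ]
  refine (Submodule.Quotient.eq _).mpr ?_
  intro a ha
  have hex : ∃ τ : Δ.cones, τ.1 ∈ Λ ∧ KC t.r t.ω τ.1.carrier a.support := ⟨τ, hτ, ha⟩
  have hcoa : co a = PP.co a (g τ) := by
    simp only [co]
    rw [dif_pos hex]
    exact hco2 _ _ hex.choose_spec.1 hτ a hex.choose_spec.2 ha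
  have h1 : PP.co a (show PP t.r from f) = PP.co a (g τ) := by
    refine (hf a).trans ?_
    split_ifs with h
    · exact hcoa
    · exact (hA a h τ).symm
  rw [PP.co_sub, sub_eq_zero]
  exact h1

lemma BB_univ_inj {Δ : Fan V} (t : Tri Δ) (b : BB t Set.univ)
    (h : ∀ σ : Δ.cones, bres t (Set.subset_univ σ.1.carrier) b = 0) : b = 0 := by
  obtain ⟨f, rfl⟩ := Submodule.Quotient.mk_surjective _ b
  rw [Submodule.Quotient.mk_eq_zero]
  intro a ha
  obtain ⟨σ, hσ, h1⟩ := t.sub _ ha.1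
  have h2 := h ⟨σ, hσ⟩
  rw [bres_mk, Submodule.Quotient.mk_eq_zero] at h2
  exact h2 a ⟨ha.1, h1⟩

lemma bd_inter {Δ : Fan V} (σ : Δ.cones) : ∀ τ τ' : Δ.cones, τ.1 ∈ FanSheaf.bdFan σ →
    τ'.1 ∈ FanSheaf.bdFan σ → ∃ υ : Δ.cones, υ.1 ∈ FanSheaf.bdFan σ ∧
      υ.1.IsFaceOf τ.1 ∧ υ.1.IsFaceOf τ'.1 ∧ υ.1.carrier = τ.1.carrier ∩ τ'.1.carrier := by
  intro τ τ' hτ hτ'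
  obtain ⟨υ, hυ, h1, h2, h3⟩ := Δ.inter_mem τ.1 τ.2 τ'.1 τ'.2
  refine ⟨⟨υ, hυ⟩, ⟨?_, ?_⟩, h1, h2, h3⟩
  · obtain ⟨⟨f, hf, hf'⟩, _⟩ := hτ
    obtain ⟨⟨g, hg, hg'⟩, _⟩ := hτ'
    refine ⟨f + g, fun x hx => add_nonneg (hf x hx) (hg x hx), ?_⟩
    rw [h3, hf', hg']
    ext x
    constructor
    · rintro ⟨⟨hx, h4⟩, _, h5⟩
      refine ⟨hx, ?_⟩
      have h4 : f x = 0 := h4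
      have h5 : g x = 0 := h5
      change f x + g x = 0
      rw [h4, h5, add_zero]
    · rintro ⟨hx, h4⟩
      have h4 : f x + g x = 0 := h4
      have h5 := hf x hx
      have h6 := hg x hx
      exact ⟨⟨hx, show f x = 0 by linarith⟩, hx, show g x = 0 by linarith⟩
  · intro he
    apply hτ.2
    apply Cone.ext'
    apply Set.Subset.antisymm (face_subset hτ.1)
    rw [← he, h3]
    exact Set.inter_subset_left

/-! ### Extending homomorphisms over the fan -/

section ext

variable {Δ : Fan V}

/-- Compatible families over `Λ`. -/
def cf (Y : Δ.cones → Type) [∀ σ, AddCommGroup (Y σ)] [∀ σ, Module (PolyRing V) (Y σ)]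
    (res : ∀ σ τ : Δ.cones, τ.1.IsFaceOf σ.1 → (Y σ →ₗ[PolyRing V] Y τ)) (Λ : Set (Cone V)) :
    Submodule (PolyRing V) (∀ τ : {τ : Δ.cones // τ.1 ∈ Λ}, Y τ.1) where
  carrier := {s | ∀ (σ τ : {τ : Δ.cones // τ.1 ∈ Λ}) (h : τ.1.1.IsFaceOf σ.1.1),
    res σ.1 τ.1 h (s σ) = s τ}
  add_mem' := by
    intro a b ha hb σ τ h
    simp [map_add, ha σ τ h, hb σ τ h]
  zero_mem' := by intro σ τ h; simp
  smul_mem' := by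
    intro c a ha σ τ h
    simp [map_smul, ha σ τ h]

theorem exists_hom
    (X : Δ.cones → Type) [∀ σ, AddCommGroup (X σ)] [∀ σ, Module (PolyRing V) (X σ)]
    (rX : ∀ σ τ : Δ.cones, τ.1.IsFaceOf σ.1 → (X σ →ₗ[PolyRing V] X τ))
    (rXs : ∀ σ h x, rX σ σ h x = x)
    (rXc : ∀ σ τ υ h1 h2 h3 x, rX τ υ h2 (rX σ τ h1 x) = rX σ υ h3 x)
    (hX : ∀ σ : Δ.cones, LP (vanishingIdeal V σ.1.carrier) (X σ))
    (Y : Δ.cones → Type) [∀ σ, AddCommGroup (Y σ)] [∀ σ, Module (PolyRing V) (Y σ)]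
    (rY : ∀ σ τ : Δ.cones, τ.1.IsFaceOf σ.1 → (Y σ →ₗ[PolyRing V] Y τ))
    (rYs : ∀ σ h x, rY σ σ h x = x)
    (rYc : ∀ σ τ υ h1 h2 h3 x, rY τ υ h2 (rY σ τ h1 x) = rY σ υ h3 x)
    (hYt : ∀ σ : Δ.cones, ∀ a ∈ vanishingIdeal V σ.1.carrier, ∀ y : Y σ, a • y = 0)
    (hYb : ∀ σ : Δ.cones, σ.1 ≠ zeroCone V → ∀ s ∈ cf Y rY (FanSheaf.bdFan σ),
      ∃ y : Y σ, ∀ τ : {τ : Δ.cones // τ.1 ∈ FanSheaf.bdFan σ}, rY σ τ.1 τ.2.1 y = s τ)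
    (f0 : X Δ.ozero →ₗ[PolyRing V] Y Δ.ozero) :
    ∃ F : ∀ σ, X σ →ₗ[PolyRing V] Y σ, F Δ.ozero = f0 ∧
      ∀ σ τ h x, rY σ τ h (F σ x) = F τ (rX σ τ h x) := by
  have : Fintype Δ.cones := Δ.finite.fintype
  have main : ∀ n : ℕ, ∀ Λ : Finset Δ.cones, Λ.card = n →
      (∀ σ ∈ Λ, ∀ τ : Δ.cones, τ.1.IsFaceOf σ.1 → τ ∈ Λ) →
      ∃ F : ∀ σ, X σ →ₗ[PolyRing V] Y σ, (Δ.ozero ∈ Λ → F Δ.ozero = f0) ∧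
        ∀ σ ∈ Λ, ∀ τ h x, rY σ τ h (F σ x) = F τ (rX σ τ h x) := by
    intro n
    induction n with
    | zero =>
      intro Λ hΛ _
      rw [Finset.card_eq_zero] at hΛ
      subst hΛ
      exact ⟨fun _ => 0, by simp, by simp⟩
    | succ n ih =>
      intro Λ hΛ hcl
      obtain ⟨σ, hσ, hmax⟩ : ∃ σ ∈ Λ, ∀ τ ∈ Λ, σ.1.carrier ⊆ τ.1.carrier → τ = σ := by
        have hne : Λ.Nonempty := by rw [← Finset.card_pos, hΛ]; omega
        obtain ⟨C, hC⟩ := (Λ.image (fun σ => σ.1.carrier)).exists_maximal (hne.image _)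
        obtain ⟨σ, hσ, rfl⟩ := Finset.mem_image.mp hC.1
        refine ⟨σ, hσ, fun τ hτ hle => ?_⟩
        have := hC.2 (Finset.mem_image_of_mem _ hτ) hle
        exact Subtype.ext (Cone.ext' (Set.Subset.antisymm this hle))
      have hcl' : ∀ ρ ∈ Λ.erase σ, ∀ τ : Δ.cones, τ.1.IsFaceOf ρ.1 → τ ∈ Λ.erase σ := by
        intro ρ hρ τ hτ
        rw [Finset.mem_erase] at hρ ⊢
        refine ⟨?_, hcl ρ hρ.2 τ hτ⟩
        rintro rfl
        exact hρ.1 (hmax ρ hρ.2 (face_subset hτ))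
      obtain ⟨F, hF0, hF⟩ := ih (Λ.erase σ) (by rw [Finset.card_erase_of_mem hσ, hΛ]; rfl) hcl'
      have key : ∃ g : X σ →ₗ[PolyRing V] Y σ, (∀ h : Δ.ozero = σ, h ▸ f0 = g) ∧
          ∀ τ h x, τ ≠ σ → rY σ τ h (g x) = F τ (rX σ τ h x) := by
        by_cases h0 : Δ.ozero = σ
        · subst h0
          refine ⟨f0, fun _ => rfl, ?_⟩
          intro τ h x hne
          exfalso
          apply hne
          apply Subtype.ext
          apply Cone.ext'
          apply Set.Subset.antisymm (face_subset h)
          intro y hy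
          have : y = 0 := hy
          rw [this]; exact cone_zero _
        · have h0' : σ.1 ≠ zeroCone V := fun h => h0 (Subtype.ext h.symm)
          let Λb := FanSheaf.bdFan σ
          let bd : Y σ →ₗ[PolyRing V] cf Y rY Λb := LinearMap.codRestrict _
            (LinearMap.pi fun τ : {τ : Δ.cones // τ.1 ∈ Λb} => rY σ τ.1 τ.2.1) (by
              intro y ρ τ h
              exact rYc _ _ _ _ _ _ _)
          have hbd : Function.Surjective bd := by
            rintro ⟨s, hs⟩
            obtain ⟨y, hy⟩ := hYb σ h0' s hs
            refine ⟨y, Subtype.ext (funext fun τ => hy τ)⟩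
          let G : X σ →ₗ[PolyRing V] cf Y rY Λb := LinearMap.codRestrict _
            (LinearMap.pi fun τ : {τ : Δ.cones // τ.1 ∈ Λb} => F τ.1 ∘ₗ rX σ τ.1 τ.2.1) (by
              intro x ρ τ h
              simp only [LinearMap.pi_apply, LinearMap.comp_apply]
              rw [hF ρ.1 (by
                rw [Finset.mem_erase]
                exact ⟨fun h => ρ.2.2 (congrArg Subtype.val h), hcl σ hσ _ ρ.2.1⟩), rXc])
          obtain ⟨g, hg⟩ := hX σ _ _ bd hbd (hYt σ) G
          refine ⟨g, fun h => absurd h h0, ?_⟩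
          intro τ h x hne
          have h1 := LinearMap.congr_fun hg x
          have h2 := congrFun (congrArg Subtype.val h1)
            ⟨τ, ⟨h, fun he => hne (Subtype.ext he)⟩⟩
          exact h2
      obtain ⟨g, hg0, hg⟩ := key
      refine ⟨Function.update F σ g, ?_, ?_⟩
      · intro h0
        by_cases hσ0 : Δ.ozero = σ
        · subst hσ0
          rw [Function.update_self]
          exact (hg0 rfl).symm
        · rw [Function.update_of_ne hσ0]
          exact hF0 (Finset.mem_erase.mpr ⟨hσ0, h0⟩)
      · intro ρ hρ τ h x
        by_cases hρσ : ρ = σ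
        · subst hρσ
          by_cases hτ : τ = ρ
          · subst hτ
            rw [rYs, rXs]
          · rw [Function.update_self, Function.update_of_ne hτ]
            exact hg τ h x hτ
        · have hρ' := Finset.mem_erase.mpr ⟨hρσ, hρ⟩
          have hτ := (Finset.mem_erase.mp (hcl' ρ hρ' τ h)).1
          rw [Function.update_of_ne hρσ, Function.update_of_ne hτ]
          exact hF ρ hρ' τ h x
  obtain ⟨F, h0, h⟩ := main _ Finset.univ rfl (fun _ _ _ _ => Finset.mem_univ _)
  exact ⟨F, h0 (Finset.mem_univ _), fun σ => h σ (Finset.mem_univ _)⟩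

end ext

end QC


namespace QC

/-! ### Gradings -/

/-- The polynomial functions that are sums of homogeneous ones of positive degree. -/
def posPart (V : Type) [AddCommGroup V] [Module ℝ V] : AddSubmonoid (PolyRing V) :=
  AddSubmonoid.closure {g | ∃ k : ℕ, 1 ≤ k ∧ g ∈ AdegN V k}

lemma posPart_mul {f g : PolyRing V} (hf : f ∈ posPart V) (hg : g ∈ posPart V) :
    f * g ∈ posPart V := by
  induction hf using AddSubmonoid.closure_induction with
  | zero => rw [zero_mul]; exact zero_mem _
  | add x y _ _ hx hy => rw [add_mul]; exact add_mem hx hy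
  | mem x hx =>
    induction hg using AddSubmonoid.closure_induction with
    | zero => rw [mul_zero]; exact zero_mem _
    | add y z _ _ hy hz => rw [mul_add]; exact add_mem hy hz
    | mem y hy =>
      obtain ⟨k, hk, h⟩ := hx
      obtain ⟨l, hl, h'⟩ := hy
      refine AddSubmonoid.subset_closure ⟨k + l, by omega, ?_⟩
      intro t v
      have h1 := h t v
      have h2 := h' t v
      change x.1 (t • v) * y.1 (t • v) = _ * (x.1 v * y.1 v)
      rw [h1, h2]; ring

lemma posPart_smul (c : ℝ) {f : PolyRing V} (hf : f ∈ posPart V) : c • f ∈ posPart V := by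
  induction hf using AddSubmonoid.closure_induction with
  | zero => rw [smul_zero]; exact zero_mem _
  | add x y _ _ hx hy => rw [smul_add]; exact add_mem hx hy
  | mem x hx =>
    obtain ⟨k, hk, h⟩ := hx
    exact AddSubmonoid.subset_closure ⟨k, hk, Submodule.smul_mem _ c h⟩

lemma sub_const_mem (f : PolyRing V) : f - f.1 0 • (1 : PolyRing V) ∈ posPart V := by
  obtain ⟨f, hf⟩ := f
  induction hf using Algebra.adjoin_induction with
  | mem f hf =>
    have h0 : f 0 = 0 := hf.map_zero
    simp only [h0, zero_smul, sub_zero]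
    refine AddSubmonoid.subset_closure ⟨1, le_refl _, ?_⟩
    intro t v
    have := hf.map_smul t v
    rw [pow_one]; exact this
  | algebraMap c =>
    convert zero_mem (posPart V)
    apply polyRing_ext
    intro x
    change c - c * 1 = 0
    ring
  | add f g hf hg h1 h2 =>
    convert add_mem h1 h2 using 1
    apply polyRing_ext
    intro x
    change (f x + g x) - (f 0 + g 0) * 1 = (f x - f 0 * 1) + (g x - g 0 * 1)
    ring
  | mul f g hf hg h1 h2 =>
    convert add_mem (add_mem (posPart_mul h1 h2) (posPart_smul (f 0) h2))
      (posPart_smul (g 0) h1) using 1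
    apply polyRing_ext
    intro x
    change (f x * g x) - (f 0 * g 0) * 1 = (f x - f 0 * 1) * (g x - g 0 * 1)
      + f 0 * (g x - g 0 * 1) + g 0 * (f x - f 0 * 1)
    ring

lemma mem_posPart {f : PolyRing V} (hf : f ∈ mId V) : f ∈ posPart V := by
  have := sub_const_mem f
  rw [mem_mId.mp hf, zero_smul, sub_zero] at this
  exact this

lemma AdegN_pos_mem_mId {k : ℕ} (hk : 1 ≤ k) {f : PolyRing V} (hf : f ∈ AdegN V k) : f ∈ mId V := by
  rw [mem_mId]
  have := hf 0 0
  rw [smul_zero, zero_pow (by omega), zero_mul] at this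
  exact this

/-- A grading of an `A`-module, by projections. -/
structure Gr (V : Type) [AddCommGroup V] [Module ℝ V] (M : Type) [AddCommGroup M] [Module (PolyRing V) M] where
  pr : ℤ → M →+ M
  pr_pr : ∀ p q x, pr p (pr q x) = if p = q then pr q x else 0
  sum : ∀ x, ∃ T : Finset ℤ, x = ∑ q ∈ T, pr q x
  sm : ∀ (k : ℕ) (a : PolyRing V), a ∈ AdegN V k → ∀ q x, pr (2 * k + q) (a • x) = a • pr q x

section Gr

variable {M : Type} [AddCommGroup M] [Module (PolyRing V) M] (G : Gr V M)

lemma Gr.sum' (x : M) {T : Finset ℤ} (hT : x = ∑ q ∈ T, G.pr q x) {T' : Finset ℤ} (h : T ⊆ T') :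
    x = ∑ q ∈ T', G.pr q x := by
  conv_lhs => rw [hT]
  apply Finset.sum_subset h
  intro q _ hq
  rw [hT, map_sum]
  apply Finset.sum_eq_zero
  intro p hp
  rw [G.pr_pr, if_neg]
  rintro rfl
  exact hq hp

lemma Gr.mSub_hom {x : M} (hx : x ∈ mSub V M) (q : ℤ) : G.pr q x ∈ mSub V M := by
  rw [mSub] at hx
  induction hx using Submodule.smul_induction_on' with
  | add x _ y _ hx hy => rw [map_add]; exact add_mem hx hy
  | smul a ha x _ =>
    have ha' := mem_posPart ha
    clear ha
    induction ha' using AddSubmonoid.closure_induction with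
    | zero => rw [zero_smul, map_zero]; exact zero_mem _
    | add a b _ _ ha hb => rw [add_smul, map_add]; exact add_mem ha hb
    | mem a ha =>
      obtain ⟨k, hk, h⟩ := ha
      have := G.sm k a h (q - 2 * k) x
      rw [add_sub_cancel] at this
      rw [this]
      exact Submodule.smul_mem_smul (AdegN_pos_mem_mId hk h) trivial

lemma Gr.pr_smul_self {a : PolyRing V} (ha : a ∈ mId V) (x : M) (q : ℤ) :
    G.pr q (a • G.pr q x) = 0 := by
  have ha' := mem_posPart ha
  clear ha
  induction ha' using AddSubmonoid.closure_induction with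
  | zero => rw [zero_smul, map_zero]
  | add a b _ _ ha hb => rw [add_smul, map_add, ha, hb, add_zero]
  | mem a ha =>
    obtain ⟨k, hk, h⟩ := ha
    have := G.sm k a h (q - 2 * k) (G.pr q x)
    rw [add_sub_cancel] at this
    rw [this, G.pr_pr, if_neg (by omega), smul_zero]

/-- Graded Nakayama. -/
lemma Gr.nakayama [Module.Finite (PolyRing V) M] (N : Submodule (PolyRing V) M)
    (hN : ∀ x ∈ N, ∀ q, G.pr q x ∈ N) (h : ∀ x : M, ∃ y ∈ N, x - y ∈ mSub V M) : N = ⊤ := by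
  obtain ⟨r, hr, hr2⟩ := Submodule.exists_sub_one_mem_and_smul_eq_zero_of_fg_of_le_smul (mId V)
    (⊤ : Submodule (PolyRing V) (M ⧸ N)) Module.Finite.fg_top (by
      rintro x -
      obtain ⟨x, rfl⟩ := N.mkQ_surjective x
      obtain ⟨y, hy, hxy⟩ := h x
      have h1 : N.mkQ x = N.mkQ (x - y) := by
        rw [map_sub, (show N.mkQ y = 0 by simpa using hy), sub_zero]
      rw [h1]
      have h2 := Submodule.mem_map_of_mem (f := N.mkQ) hxy
      rw [mSub, Submodule.map_smul''] at h2
      exact Submodule.smul_mono le_rfl le_top h2)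
  have key : ∀ x q, G.pr q x ∈ N := by
    intro x q
    have h1 : r • G.pr q x ∈ N := by
      have := hr2 (N.mkQ (G.pr q x)) trivial
      rw [← map_smul] at this
      exact (Submodule.Quotient.mk_eq_zero N).mp this
    have h2 := hN _ h1 q
    have h3 : r • G.pr q x = G.pr q x + (r - 1) • G.pr q x := by
      rw [sub_smul, one_smul]; abel
    rw [h3, map_add, G.pr_smul_self hr, add_zero, G.pr_pr, if_pos rfl] at h2
    exact h2
  rw [eq_top_iff]
  rintro x -
  obtain ⟨T, hT⟩ := G.sum x
  rw [hT]
  exact sum_mem fun q _ => key x q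

end Gr

/-- The grading of a graded module. -/
def gmGr (M : GAMod V) : Gr V M.M := by
  letI := M.internal.chooseDecomposition
  exact
  { pr := fun q =>
      { toFun := fun x => (DirectSum.decompose M.deg x q : M.M)
        map_zero' := by simp
        map_add' := by intro x y; simp }
    pr_pr := by
      intro p q x
      change (DirectSum.decompose M.deg (DirectSum.decompose M.deg x q : M.M) p : M.M) = _
      split_ifs with h
      · subst h
        exact DirectSum.decompose_of_mem_same _ (SetLike.coe_mem _)
      · exact DirectSum.decompose_of_mem_ne _ (SetLike.coe_mem _) (Ne.symm h)
    sum := by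
      intro x
      exact ⟨_, (DirectSum.sum_support_decompose M.deg x).symm⟩
    sm := by
      intro k a ha q x
      have hA : a ∈ Adeg V (2 * k) :=
        (le_iSup₂_of_le (f := fun (k' : ℕ) (_ : (2 * (k : ℤ)) = 2 * k') => AdegN V k')
          k rfl le_rfl) ha
      change (DirectSum.decompose M.deg (a • x) (2 * k + q) : M.M)
        = a • (DirectSum.decompose M.deg x q : M.M)
      induction x using DirectSum.Decomposition.inductionOn M.deg with
      | zero => simp
      | add x y hx hy =>
        simp only [smul_add, DirectSum.decompose_add, DirectSum.add_apply, Submodule.coe_add] at hx hy ⊢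
        rw [hx, hy]
      | @homogeneous p x =>
        have h1 := M.smul_deg (2 * k) p a hA x x.2
        by_cases hpq : p = q
        · subst hpq
          rw [DirectSum.decompose_of_mem_same _ h1, DirectSum.decompose_of_mem_same _ x.2]
        · rw [DirectSum.decompose_of_mem_ne _ h1 (by omega),
            DirectSum.decompose_of_mem_ne _ x.2 hpq, smul_zero] }

lemma gmGr_mem (M : GAMod V) (q : ℤ) (x : M.M) : (gmGr M).pr q x ∈ M.deg q := by
  let _ := M.internal.chooseDecomposition
  exact (DirectSum.decompose M.deg x q).2

lemma gmGr_of_mem (M : GAMod V) {q : ℤ} {x : M.M} (hx : x ∈ M.deg q) (p : ℤ) :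
    (gmGr M).pr p x = if p = q then x else 0 := by
  let _ := M.internal.chooseDecomposition
  change (DirectSum.decompose M.deg x p : M.M) = _
  split_ifs with h
  · subst h
    exact DirectSum.decompose_of_mem_same _ hx
  · exact DirectSum.decompose_of_mem_ne _ hx (Ne.symm h)

lemma gmGr_hom {M N : GAMod V} (f : GHom M N) (q : ℤ) (x : M.M) :
    f.toLin ((gmGr M).pr q x) = (gmGr N).pr q (f.toLin x) := by
  obtain ⟨T, hT⟩ := (gmGr M).sum x
  conv_rhs => rw [hT, map_sum, map_sum]
  have h1 : ∀ p ∈ T, (gmGr N).pr q (f.toLin ((gmGr M).pr p x)) =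
      f.toLin ((gmGr M).pr q ((gmGr M).pr p x)) := by
    intro p _
    rw [gmGr_of_mem N (f.deg_mem p _ (gmGr_mem M p x)) q, (gmGr M).pr_pr]
    split_ifs
    · rfl
    · rw [map_zero]
  rw [Finset.sum_congr rfl h1, ← map_sum, ← map_sum, ← hT]

end QC


namespace QC

section sheaf

variable {Δ : Fan V} (F : FanSheaf Δ)

/-- The grading on sections. -/
def secGr (Λ : Set (Cone V)) : Gr V (F.Sec Λ) where
  pr q :=
    { toFun := fun s => ⟨fun σ => (gmGr (F.stalk σ)).pr q (s.1 σ), by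
        refine ⟨fun σ hσ => ?_, fun σ τ hσ hτ h => ?_⟩
        · change (gmGr (F.stalk σ)).pr q (s.1 σ) = 0
          rw [s.2.1 σ hσ, map_zero]
        · rw [gmGr_hom, s.2.2 σ τ hσ hτ h]⟩
      map_zero' := Subtype.ext (funext fun σ => map_zero _)
      map_add' := fun s t => Subtype.ext (funext fun σ => map_add _ _ _) }
  pr_pr p q s := by
    apply Subtype.ext
    funext σ
    change (gmGr (F.stalk σ)).pr p ((gmGr (F.stalk σ)).pr q (s.1 σ)) = _
    rw [(gmGr (F.stalk σ)).pr_pr]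
    split_ifs <;> rfl
  sum s := by
    have : Fintype Δ.cones := Δ.finite.fintype
    choose T hT using fun σ => (gmGr (F.stalk σ)).sum (s.1 σ)
    refine ⟨Finset.univ.biUnion T, Subtype.ext (funext fun σ => ?_)⟩
    have h1 := (gmGr (F.stalk σ)).sum' _ (hT σ)
      (Finset.subset_biUnion_of_mem T (Finset.mem_univ σ))
    rw [AddSubmonoidClass.coe_finsetSum, Finset.sum_apply]
    exact h1
  sm k a ha q s := Subtype.ext (funext fun σ => (gmGr (F.stalk σ)).sm k a ha q (s.1 σ))

lemma secGr_mem (Λ : Set (Cone V)) (q : ℤ) (s : F.Sec Λ) :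
    (secGr F Λ).pr q s ∈ F.secDeg Λ q := fun σ => gmGr_mem (F.stalk σ) q (s.1 σ)

lemma bdRes_pr (σ : Δ.cones) (q : ℤ) (x : (F.stalk σ).M) :
    F.bdRes σ ((gmGr (F.stalk σ)).pr q x) = (secGr F (FanSheaf.bdFan σ)).pr q (F.bdRes σ x) := by
  apply Subtype.ext
  funext τ
  change (if h : Cone.IsProperFaceOf τ.1 σ.1 then
      (F.res σ τ h.1).toLin ((gmGr (F.stalk σ)).pr q x) else 0) =
    (gmGr (F.stalk τ)).pr q (if h : Cone.IsProperFaceOf τ.1 σ.1 then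
      (F.res σ τ h.1).toLin x else 0)
  split_ifs with h
  · exact gmGr_hom _ _ _
  · rw [map_zero]

lemma bdRes_apply (σ τ : Δ.cones) (h : τ.1 ∈ FanSheaf.bdFan σ) (x : (F.stalk σ).M) :
    (F.bdRes σ x).1 τ = (F.res σ τ h.1).toLin x := dif_pos h

/-- injectivity modulo `m` -/
lemma bdRes_inj_mod (hF : F.CondLME) (σ : Δ.cones) (hσ : σ.1 ≠ zeroCone V) (x : (F.stalk σ).M)
    (hx : F.bdRes σ x ∈ mSub V (F.Sec (FanSheaf.bdFan σ))) : x ∈ mSub V (F.stalk σ).M := by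
  obtain ⟨T, hT⟩ := (gmGr (F.stalk σ)).sum x
  rw [hT]
  apply sum_mem
  intro q _
  have h1 : F.bdRes σ ((gmGr (F.stalk σ)).pr q x) ∈ mSub V (F.Sec (FanSheaf.bdFan σ)) := by
    rw [bdRes_pr]
    exact (secGr F _).mSub_hom hx q
  have h2 := (hF σ hσ q).injOn
    (x₁ := (mSub V (F.stalk σ).M).mkQ ((gmGr (F.stalk σ)).pr q x)) (x₂ := 0)
    (Submodule.mem_map.mpr ⟨_, gmGr_mem _ q x, rfl⟩) (zero_mem _) (by
      rw [map_zero]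
      exact (Submodule.Quotient.mk_eq_zero _).mpr h1)
  exact (Submodule.Quotient.mk_eq_zero _).mp h2

/-- surjectivity modulo `m` -/
lemma bdRes_surj_mod (hF : F.CondLME) (σ : Δ.cones) (hσ : σ.1 ≠ zeroCone V)
    (s : F.Sec (FanSheaf.bdFan σ)) :
    ∃ x, s - F.bdRes σ x ∈ mSub V (F.Sec (FanSheaf.bdFan σ)) := by
  have key : ∀ q, ∃ x, (secGr F _).pr q s - F.bdRes σ x ∈
      mSub V (F.Sec (FanSheaf.bdFan σ)) := by
    intro q
    obtain ⟨y, hy, hy2⟩ := (hF σ hσ q).surjOn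
      (a := (mSub V (F.Sec (FanSheaf.bdFan σ))).mkQ ((secGr F _).pr q s))
      (Submodule.mem_map.mpr ⟨_, secGr_mem F _ q s, rfl⟩)
    obtain ⟨x, hx, rfl⟩ := Submodule.mem_map.mp hy
    refine ⟨x, ?_⟩
    exact (Submodule.Quotient.eq _).mp hy2.symm
  choose x hx using key
  obtain ⟨T, hT⟩ := (secGr F _).sum s
  refine ⟨∑ q ∈ T, x q, ?_⟩
  have h1 : s - F.bdRes σ (∑ q ∈ T, x q) = ∑ q ∈ T, ((secGr F _).pr q s - F.bdRes σ (x q)) := by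
    rw [Finset.sum_sub_distrib, ← hT, map_sum]
  rw [h1]
  exact sum_mem fun q _ => hx q

lemma bdRes_surj (hF : F.CondLME) (σ : Δ.cones) (hσ : σ.1 ≠ zeroCone V)
    (hfin : Module.Finite (PolyRing V) (F.Sec (FanSheaf.bdFan σ))) :
    Function.Surjective (F.bdRes σ) := by
  rw [← LinearMap.range_eq_top]
  apply (secGr F _).nakayama
  · rintro _ ⟨x, rfl⟩ q
    exact ⟨_, bdRes_pr F σ q x⟩
  · intro s
    obtain ⟨x, hx⟩ := bdRes_surj_mod F hF σ hσ s
    exact ⟨_, ⟨x, rfl⟩, hx⟩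

lemma sec_finite [FiniteDimensional ℝ V] (Λ : Set (Cone V))
    (h : ∀ σ : Δ.cones, σ.1 ∈ Λ → Module.Finite (PolyRing V) (F.stalk σ).M) :
    Module.Finite (PolyRing V) (F.Sec Λ) := by
  have : Finite Δ.cones := Δ.finite
  have : ∀ σ : {σ : Δ.cones // σ.1 ∈ Λ}, Module.Finite (PolyRing V) (F.stalk σ.1).M :=
    fun σ => h _ σ.2
  let f : F.Sec Λ →ₗ[PolyRing V] (∀ σ : {σ : Δ.cones // σ.1 ∈ Λ}, (F.stalk σ.1).M) :=
    LinearMap.pi fun σ => LinearMap.proj σ.1 ∘ₗ (F.secSub Λ).subtype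
  apply Module.Finite.of_injective f
  intro s t hst
  apply Subtype.ext
  funext σ
  by_cases hσ : σ.1 ∈ Λ
  · exact congrFun hst ⟨σ, hσ⟩
  · rw [s.2.1 σ hσ, t.2.1 σ hσ]

/-- evaluation at zero on the cone ring -/
def cev (σ : Cone V) : coneRing V σ →+* ℝ :=
  Ideal.Quotient.lift _ (evalRH V 0) (fun _ ha => mem_vanishing.mp ha 0 (cone_zero σ))

lemma finite_of_free (σ : Cone V) (M : Type) [AddCommGroup M] [Module (PolyRing V) M]
    (h : FreeOverCone V σ M) (N : Submodule (PolyRing V) M) (hN : N.FG)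
    (hs : ∀ x : M, ∃ y ∈ N, x - y ∈ mSub V M) : Module.Finite (PolyRing V) M := by
  obtain ⟨h, hfree⟩ := h
  let _ := h.module
  have hfree : Module.Free (coneRing V σ) M := hfree
  let b := Module.Free.chooseBasis (coneRing V σ) M
  have hsm : ∀ (a : PolyRing V) (x : M), a • x = (Ideal.Quotient.mk _ a : coneRing V σ) • x :=
    fun a x => rfl
  obtain ⟨S, hS⟩ := hN
  let J : Finset (Module.Free.ChooseBasisIndex (coneRing V σ) M) :=
    S.biUnion (fun x => (b.repr x).support)
  let φ : (Module.Free.ChooseBasisIndex (coneRing V σ) M) → M → ℝ := fun i x => cev σ (b.repr x i)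
  have φadd : ∀ i x y, φ i (x + y) = φ i x + φ i y := by intro i x y; simp [φ]
  have φsm : ∀ i (a : PolyRing V) x, φ i (a • x) = a.1 0 * φ i x := by
    intro i a x
    simp only [φ, hsm, map_smul, Finsupp.smul_apply, smul_eq_mul, map_mul]
    rfl
  have φm : ∀ i x, x ∈ mSub V M → φ i x = 0 := by
    intro i x hx
    rw [mSub] at hx
    induction hx using Submodule.smul_induction_on' with
    | add x _ y _ hx hy => rw [φadd, hx, hy, add_zero]
    | smul a ha x _ => rw [φsm, mem_mId.mp ha, zero_mul]
  have hJ : ∀ i, i ∈ J := by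
    intro i
    by_contra hi
    have h1 : ∀ y ∈ N, φ i y = 0 := by
      intro y hy
      rw [← hS] at hy
      induction hy using Submodule.span_induction with
      | mem y hy =>
        have : b.repr y i = 0 := by
          by_contra h2
          exact hi (Finset.mem_biUnion.mpr ⟨y, hy, Finsupp.mem_support_iff.mpr h2⟩)
        simp [φ, this]
      | zero => simp [φ]
      | add x y _ _ hx hy => rw [φadd, hx, hy, add_zero]
      | smul a x _ hx => rw [φsm, hx, mul_zero]
    obtain ⟨y, hy, hxy⟩ := hs (b i)
    have h2 := φadd i (b i - y) y
    rw [sub_add_cancel, φm i _ hxy, h1 y hy] at h2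
    simp [φ] at h2
  have hfin : Finite (Module.Free.ChooseBasisIndex (coneRing V σ) M) :=
    @Finite.of_fintype _ ⟨J, hJ⟩
  have h3 : Module.Finite (coneRing V σ) M := Module.Finite.of_basis b
  have : IsScalarTower (PolyRing V) (coneRing V σ) M := ⟨by
    intro a c x
    obtain ⟨c, rfl⟩ := Ideal.Quotient.mk_surjective c
    have : a • (Ideal.Quotient.mk _ c : coneRing V σ) = Ideal.Quotient.mk _ (a * c) := rfl
    rw [this, ← hsm, ← hsm, mul_smul]⟩
  exact Module.Finite.trans (coneRing V σ) M

lemma stalk_finite [FiniteDimensional ℝ V] (hF : F.IsMES) (σ : Δ.cones) :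
    Module.Finite (PolyRing V) (F.stalk σ).M := by
  have : Fintype Δ.cones := Δ.finite.fintype
  have main : ∀ n : ℕ, ∀ σ : Δ.cones,
      (Finset.univ.filter fun τ : Δ.cones => τ.1.carrier ⊆ σ.1.carrier).card = n →
      Module.Finite (PolyRing V) (F.stalk σ).M := by
    intro n
    induction n using Nat.strong_induction_on with
    | _ n ih =>
    intro σ hσn
    by_cases h0 : σ = Δ.ozero
    · subst h0
      have : Module.Finite ℝ (F.stalk Δ.ozero).M :=
        Module.finite_of_finrank_pos (by rw [hF.1.2.1]; norm_num)
      exact Module.Finite.of_restrictScalars_finite ℝ (PolyRing V) _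
    · have h0' : σ.1 ≠ zeroCone V := fun h => h0 (Subtype.ext h)
      have hfin : Module.Finite (PolyRing V) (F.Sec (FanSheaf.bdFan σ)) := by
        apply sec_finite
        intro τ hτ
        refine ih _ ?_ τ rfl
        rw [← hσn]
        apply Finset.card_lt_card
        rw [Finset.ssubset_iff_of_subset]
        · refine ⟨σ, by simp, ?_⟩
          simp only [Finset.mem_filter, Finset.mem_univ, true_and]
          intro hle
          exact hτ.2 (Cone.ext' (Set.Subset.antisymm (face_subset hτ.1) hle))
        · intro ρ
          simp only [Finset.mem_filter, Finset.mem_univ, true_and]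
          exact fun h => h.trans (face_subset hτ.1)
      have hsurj := bdRes_surj F hF.2.2 σ h0' hfin
      obtain ⟨S, hS⟩ := hfin.fg_top
      choose g hg using hsurj
      have hgN : ∀ x : (F.stalk σ).M, ∃ y ∈ Submodule.span (PolyRing V) (S.image g : Set (F.stalk σ).M),
          F.bdRes σ y = F.bdRes σ x := by
        intro x
        generalize F.bdRes σ x = s
        have hx : s ∈ Submodule.span (PolyRing V) (S : Set (F.Sec (FanSheaf.bdFan σ))) := by
          rw [hS]; trivial
        induction hx using Submodule.span_induction with
        | mem s hs =>
          exact ⟨g s, Submodule.subset_span (Finset.mem_coe.mpr (Finset.mem_image_of_mem g hs)), hg s⟩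
        | zero => exact ⟨0, zero_mem _, map_zero _⟩
        | add s t _ _ h1 h2 =>
          obtain ⟨y, hy, rfl⟩ := h1
          obtain ⟨z, hz, rfl⟩ := h2
          exact ⟨y + z, add_mem hy hz, map_add _ _ _⟩
        | smul a s _ h1 =>
          obtain ⟨y, hy, rfl⟩ := h1
          exact ⟨a • y, Submodule.smul_mem _ a hy, map_smul _ _ _⟩
      apply finite_of_free σ.1 _ (hF.2.1 σ) _ ⟨S.image g, rfl⟩
      intro x
      obtain ⟨y, hy, hxy⟩ := hgN x
      refine ⟨y, hy, bdRes_inj_mod F hF.2.2 σ h0' _ ?_⟩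
      rw [map_sub, hxy, sub_self]
      exact zero_mem _
  exact main _ σ rfl

lemma bdRes_surj' [FiniteDimensional ℝ V] (hF : F.IsMES) (σ : Δ.cones) (hσ : σ.1 ≠ zeroCone V) :
    Function.Surjective (F.bdRes σ) :=
  bdRes_surj F hF.2.2 σ hσ (sec_finite F _ fun τ _ => stalk_finite F hF τ)

end sheaf

end QC


namespace QC

/-! ### Endomorphisms that are invertible near the origin -/

section endo

variable {M : Type} [AddCommGroup M] [Module (PolyRing V) M]

/-- `f` is killed by a polynomial with constant coefficient in `1 + m`. -/
def Quasi (f : M →ₗ[PolyRing V] M) : Prop :=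
  ∃ r : Polynomial (PolyRing V), r.coeff 0 - 1 ∈ mId V ∧ Polynomial.aeval f r = 0

lemma Quasi.factor {f : M →ₗ[PolyRing V] M} (h : Quasi f) :
    ∃ a : PolyRing V, a - 1 ∈ mId V ∧ ∃ g : M →ₗ[PolyRing V] M, ∀ x, a • x = f (g x) := by
  obtain ⟨r, hr, h⟩ := h
  refine ⟨r.coeff 0, hr, - Polynomial.aeval f r.divX, fun x => ?_⟩
  have h1 : Polynomial.aeval f (Polynomial.X * r.divX + Polynomial.C (r.coeff 0)) = 0 := by
    rw [Polynomial.X_mul_divX_add, h]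
  rw [map_add, map_mul, Polynomial.aeval_X, Polynomial.aeval_C] at h1
  have h2 := LinearMap.congr_fun h1 x
  rw [LinearMap.add_apply, Module.End.mul_apply, Module.algebraMap_end_apply] at h2
  rw [LinearMap.neg_apply, map_neg]
  exact (neg_eq_of_add_eq_zero_right h2).symm

lemma Quasi.surj_mod {f : M →ₗ[PolyRing V] M} (h : Quasi f) (x : M) :
    ∃ y, x - f y ∈ mSub V M := by
  obtain ⟨a, ha, g, hg⟩ := h.factor
  refine ⟨g x, ?_⟩
  rw [← hg, ← neg_sub, show a • x - x = (a - 1) • x by rw [sub_smul, one_smul]]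
  exact neg_mem (Submodule.smul_mem_smul ha trivial)

lemma Quasi.of_surj_mod [Module.Finite (PolyRing V) M] {f : M →ₗ[PolyRing V] M}
    (h : ∀ x, ∃ y, x - f y ∈ mSub V M) : Quasi f := by
  let J : Ideal (Polynomial (PolyRing V)) :=
    (mId V).comap (Polynomial.constantCoeff)
  have hf : Module.Finite (Polynomial (PolyRing V)) (Module.AEval' f) := inferInstance
  obtain ⟨r, hr, hr2⟩ := Submodule.exists_sub_one_mem_and_smul_eq_zero_of_fg_of_le_smul J
    (⊤ : Submodule (Polynomial (PolyRing V)) (Module.AEval' f)) hf.fg_top (by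
      have hm : ∀ x ∈ mSub V M, Module.AEval'.of f x ∈
          J • (⊤ : Submodule (Polynomial (PolyRing V)) (Module.AEval' f)) := by
        intro x hx
        rw [mSub] at hx
        induction hx using Submodule.smul_induction_on' with
        | add x _ y _ hx hy => rw [map_add]; exact add_mem hx hy
        | smul a ha x _ =>
          have h1 : Module.AEval'.of f (a • x) = (Polynomial.C a) • Module.AEval'.of f x := by
            rw [Module.AEval.C_smul]; rfl
          rw [h1]
          refine Submodule.smul_mem_smul ?_ trivial
          change Polynomial.constantCoeff (Polynomial.C a) ∈ mId V
          simpa using ha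
      rintro x -
      obtain ⟨x, rfl⟩ := (Module.AEval'.of f).surjective x
      obtain ⟨y, hy⟩ := h x
      have h1 : Module.AEval'.of f x = Module.AEval'.of f (x - f y) +
          (Polynomial.X : Polynomial (PolyRing V)) • Module.AEval'.of f y := by
        rw [Module.AEval'.X_smul_of, ← map_add, sub_add_cancel]
      rw [h1]
      refine add_mem (hm _ hy) (Submodule.smul_mem_smul ?_ trivial)
      change Polynomial.constantCoeff Polynomial.X ∈ mId V
      simp)
  refine ⟨r, ?_, ?_⟩
  · have h1 : Polynomial.constantCoeff (r - 1) ∈ mId V := hr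
    simpa using h1
  · apply LinearMap.ext
    intro x
    have h1 := hr2 (Module.AEval'.of f x) trivial
    have h2 : r • Module.AEval'.of f x = Module.AEval'.of f (Polynomial.aeval f r x) := rfl
    rw [h2] at h1
    exact (Module.AEval'.of f).map_eq_zero_iff.mp h1

lemma aeval_comm {N : Type} [AddCommGroup N] [Module (PolyRing V) N] (π : M →ₗ[PolyRing V] N)
    (f : M →ₗ[PolyRing V] M) (g : N →ₗ[PolyRing V] N) (h : ∀ x, π (f x) = g (π x))
    (r : Polynomial (PolyRing V)) (x : M) :
    π (Polynomial.aeval f r x) = Polynomial.aeval g r (π x) := by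
  induction r using Polynomial.induction_on' generalizing x with
  | add p q hp hq => simp only [map_add, LinearMap.add_apply, hp, hq]
  | monomial n a =>
    rw [Polynomial.aeval_monomial, Polynomial.aeval_monomial, Module.End.mul_apply,
      Module.End.mul_apply, Module.algebraMap_end_apply, Module.algebraMap_end_apply, map_smul]
    congr 1
    induction n generalizing x with
    | zero => simp
    | succ n ih =>
      rw [pow_succ, pow_succ, Module.End.mul_apply, Module.End.mul_apply, ih, h]

lemma Quasi.of_family {ι : Type} [Fintype ι] {f : M →ₗ[PolyRing V] M}
    (N : ι → Type) [∀ i, AddCommGroup (N i)] [∀ i, Module (PolyRing V) (N i)]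
    (π : ∀ i, M →ₗ[PolyRing V] N i) (hπ : ∀ x, (∀ i, π i x = 0) → x = 0)
    (g : ∀ i, N i →ₗ[PolyRing V] N i) (h : ∀ i x, π i (f x) = g i (π i x))
    (hg : ∀ i, Quasi (g i)) : Quasi f := by
  choose r hr hr2 using hg
  refine ⟨∏ i, r i, ?_, ?_⟩
  · have h1 : ∀ i, (evalRH V 0) ((r i).coeff 0) = 1 := by
      intro i
      have h2 : evalRH V 0 ((r i).coeff 0 - 1) = 0 := hr i
      rw [map_sub, map_one, sub_eq_zero] at h2
      exact h2
    change evalRH V 0 ((∏ i, r i).coeff 0 - 1) = 0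
    rw [map_sub, map_one, ← Polynomial.constantCoeff_apply, map_prod, map_prod]
    simp only [Polynomial.constantCoeff_apply, h1, Finset.prod_const_one, sub_self]
  · apply LinearMap.ext
    intro x
    apply hπ
    intro i
    rw [aeval_comm (π i) f (g i) (h i), ← Finset.prod_erase_mul _ _ (Finset.mem_univ i), map_mul,
      hr2, mul_zero, LinearMap.zero_apply]

end endo

/-! ### The freeness criterion -/

theorem free_of_factor [FiniteDimensional ℝ V] {M : Type} [AddCommGroup M] [Module (PolyRing V) M]
    [Module ℝ M] [IsScalarTower ℝ (PolyRing V) M] [Module.Finite (PolyRing V) M] (G : Gr V M)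
    (a : PolyRing V) (ha : a - 1 ∈ mId V)
    (B : Type) [AddCommGroup B] [Module (PolyRing V) B] (hB : LP (V := V) ⊥ B)
    (u : M →ₗ[PolyRing V] B) (v : B →ₗ[PolyRing V] M) (huv : ∀ x, a • x = v (u x)) :
    Module.Free (PolyRing V) M := by
  let Q : M →ₗ[PolyRing V] mRed V M := (mSub V M).mkQ
  have hsmQ : ∀ (c : PolyRing V) (x : M), Q (c • x) = (c.1 0) • Q x := by
    intro c x
    have h1 : c • x = (c - c.1 0 • (1 : PolyRing V)) • x + c.1 0 • x := by
      rw [sub_smul, smul_assoc, one_smul, sub_add_cancel]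
    rw [h1, map_add]
    have h2 : Q ((c - c.1 0 • (1 : PolyRing V)) • x) = 0 := by
      apply (Submodule.Quotient.mk_eq_zero _).mpr
      refine Submodule.smul_mem_smul ?_ trivial
      rw [mem_mId]
      change c.1 0 - c.1 0 * 1 = 0
      ring
    rw [h2, zero_add]
    rfl
  let H : Set (mRed V M) := {y | ∃ x q, G.pr q x = x ∧ Q x = y}
  obtain ⟨b, hbH, hbspan, hbind⟩ := exists_linearIndependent ℝ H
  choose l hl using fun y : b => hbH y.2
  choose d hd hd2 using hl
  let π : (b →₀ PolyRing V) →ₗ[PolyRing V] M := Finsupp.linearCombination (PolyRing V) l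
  -- surjectivity
  have hspan : ∀ y ∈ Submodule.span ℝ b, ∃ n ∈ LinearMap.range π, Q n = y := by
    intro y hy
    induction hy using Submodule.span_induction with
    | mem y hy =>
      exact ⟨l ⟨y, hy⟩, ⟨Finsupp.single ⟨y, hy⟩ 1, by simp [π]⟩, hd2 ⟨y, hy⟩⟩
    | zero => exact ⟨0, zero_mem _, map_zero _⟩
    | add y z _ _ h1 h2 =>
      obtain ⟨n, hn, rfl⟩ := h1
      obtain ⟨n', hn', rfl⟩ := h2
      exact ⟨n + n', add_mem hn hn', map_add _ _ _⟩
    | smul c y _ h1 =>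
      obtain ⟨n, hn, rfl⟩ := h1
      refine ⟨(c • (1 : PolyRing V)) • n, Submodule.smul_mem _ _ hn, ?_⟩
      rw [hsmQ]
      congr 1
      change c * 1 = c
      ring
  have hgr : ∀ x ∈ LinearMap.range π, ∀ q, G.pr q x ∈ LinearMap.range π := by
    rintro _ ⟨c, rfl⟩ q
    have hrange : ∀ y, l y ∈ LinearMap.range π := fun y => ⟨Finsupp.single y 1, by simp [π]⟩
    have h1 : ∀ (c : PolyRing V) (y : b), G.pr q (c • l y) ∈ LinearMap.range π := by
      intro c y
      have h2 : c • l y = (c - c.1 0 • (1 : PolyRing V)) • l y + (c.1 0 • (1 : PolyRing V)) • l y := by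
        rw [sub_smul, sub_add_cancel]
      have hk0 : ∀ (k : ℕ) (e : PolyRing V), e ∈ AdegN V k → G.pr q (e • l y) ∈ LinearMap.range π := by
        intro k e he
        have h3 := G.sm k e he (q - 2 * k) (l y)
        rw [add_sub_cancel] at h3
        rw [h3, ← hd y, G.pr_pr]
        split_ifs
        · rw [hd y]; exact Submodule.smul_mem _ _ (hrange y)
        · rw [smul_zero]; exact zero_mem _
      rw [h2, map_add]
      apply add_mem
      · have h4 := sub_const_mem c
        generalize c - c.1 0 • (1 : PolyRing V) = e at h4
        induction h4 using AddSubmonoid.closure_induction with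
        | zero => rw [zero_smul, map_zero]; exact zero_mem _
        | add a b _ _ ha hb => rw [add_smul, map_add]; exact add_mem ha hb
        | mem e he =>
          obtain ⟨k, _, h⟩ := he
          exact hk0 k e h
      · apply hk0 0
        intro t x
        change c.1 0 * 1 = t ^ 0 * (c.1 0 * 1)
        ring
    rw [Finsupp.linearCombination_apply, Finsupp.sum, map_sum]
    exact sum_mem fun y _ => h1 _ y
  have hsurj : Function.Surjective π := by
    rw [← LinearMap.range_eq_top]
    apply G.nakayama _ hgr
    intro x
    have hx : Q x ∈ Submodule.span ℝ b := by
      rw [hbspan]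
      obtain ⟨T, hT⟩ := G.sum x
      rw [hT, map_sum]
      refine sum_mem fun q _ => Submodule.subset_span ⟨G.pr q x, q, ?_, rfl⟩
      rw [G.pr_pr, if_pos rfl]
    obtain ⟨n, hn, hn2⟩ := hspan _ hx
    exact ⟨n, hn, (Submodule.Quotient.eq _).mp hn2.symm⟩
  -- the kernel
  have hker : ∀ x, π x = 0 → ∀ y, x y ∈ mId V := by
    intro x hx
    have h1 : Q (π x) = 0 := by rw [hx, map_zero]
    rw [Finsupp.linearCombination_apply, Finsupp.sum, map_sum] at h1
    have h2 : ∑ y ∈ x.support, ((x y).1 0) • (y : mRed V M) = 0 := by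
      rw [← h1]
      apply Finset.sum_congr rfl
      intro y _
      rw [hsmQ, hd2]
    have h3 := linearIndependent_iff'.mp hbind x.support (fun y => (x y).1 0) h2
    intro y
    rw [mem_mId]
    by_cases hy : y ∈ x.support
    · exact h3 y hy
    · rw [Finsupp.notMem_support_iff.mp hy]; rfl
  obtain ⟨v', hv'⟩ := projective_of_LP_bot hB π hsurj v
  let D : (b →₀ PolyRing V) →ₗ[PolyRing V] (b →₀ PolyRing V) :=
    a • LinearMap.id - v' ∘ₗ u ∘ₗ π
  have hD : ∀ x, D x ∈ LinearMap.ker π := by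
    intro x
    rw [LinearMap.mem_ker]
    have h1 : π (v' (u (π x))) = v (u (π x)) := LinearMap.congr_fun hv' _
    simp only [D, LinearMap.sub_apply, LinearMap.smul_apply, LinearMap.id_apply,
      LinearMap.comp_apply, map_sub, map_smul]
    rw [h1, huv, sub_self]
  have hDK : ∀ x, π x = 0 → D x = a • x := by
    intro x hx
    simp [D, hx]
  have hK : LinearMap.ker π ≤ mId V • LinearMap.ker π := by
    intro x hx
    have h1 : a • x ∈ mId V • LinearMap.ker π := by
      rw [← hDK x hx, ← Finsupp.sum_single x, Finsupp.sum, map_sum]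
      refine sum_mem fun y _ => ?_
      have h2 : Finsupp.single y (x y) = x y • Finsupp.single y (1 : PolyRing V) := by simp
      rw [h2, map_smul]
      exact Submodule.smul_mem_smul (hker x hx y) (hD _)
    have h2 : x = a • x - (a - 1) • x := by
      rw [sub_smul, one_smul]; abel
    rw [h2]
    exact sub_mem h1 (Submodule.smul_mem_smul ha hx)
  have hpow : ∀ n : ℕ, LinearMap.ker π ≤ (mId V) ^ n • LinearMap.ker π := by
    intro n
    induction n with
    | zero => simp
    | succ n ih =>
      rw [pow_succ, mul_smul]
      exact ih.trans (Submodule.smul_mono le_rfl hK)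
  have hmne : mId V ≠ ⊤ := by
    rw [Ne, Ideal.eq_top_iff_one, mem_mId]
    exact one_ne_zero
  have hinf := Ideal.iInf_pow_eq_bot_of_isDomain (mId V) hmne
  have hinj : Function.Injective π := by
    rw [← LinearMap.ker_eq_bot, eq_bot_iff]
    intro x hx
    rw [Submodule.mem_bot]
    ext1 y
    have h1 : x y ∈ (⨅ n : ℕ, (mId V) ^ n) := by
      rw [Submodule.mem_iInf]
      intro n
      have h2 := Submodule.mem_map_of_mem (f := Finsupp.lapply (R := PolyRing V) y) (hpow n hx)
      rw [Submodule.map_smul''] at h2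
      have h3 := Submodule.smul_mono (le_refl (mId V ^ n)) (le_top : _ ≤ (⊤ : Ideal (PolyRing V))) h2
      simpa using h3
    rw [hinf] at h1
    exact h1
  exact Module.Free.of_equiv (LinearEquiv.ofBijective π ⟨hinj, hsurj⟩)

end QC


namespace QC

section final

variable {Δ : Fan V} (F : FanSheaf Δ)

lemma TK_empty (t : Tri Δ) : TK t.r t.ω ∅ := by
  obtain ⟨T, h, _⟩ := t.cov 0
  exact h.mono (Finset.empty_subset _)

lemma co_zero_smul (t : Tri Δ) (a : PolyRing V) (f : PP t.r) :
    PP.co 0 (a • f) = a.1 0 * PP.co 0 f := by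
  have h1 : PP.co 0 (a • f) = MvPolynomial.constantCoeff (theta t.r a *
    (show MvPolynomial t.ι ℝ from f)) := rfl
  have h2 : MvPolynomial.constantCoeff (theta t.r a) = a.1 0 := by
    have := eval_theta t.r a 0
    rw [MvPolynomial.eval_zero] at this
    rw [this]
    simp
  rw [h1, map_mul, h2]
  rfl

lemma exists_psi0 (t : Tri Δ) (hF : F.CondN) :
    ∃ f : BB t Δ.ozero.1.carrier →ₗ[PolyRing V] (F.stalk Δ.ozero).M, Function.Surjective f := by
  obtain ⟨htor, hrk, _⟩ := hF
  obtain ⟨e, _, he⟩ := finrank_eq_one_iff'.mp hrk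
  have hact : ∀ (a : PolyRing V) (x : (F.stalk Δ.ozero).M), a • x = a.1 0 • x := by
    intro a x
    have h1 : a - a.1 0 • (1 : PolyRing V) ∈ mId V := by
      rw [mem_mId]
      change a.1 0 - a.1 0 * 1 = 0
      ring
    have h2 := htor (x := x) (a := ⟨_, h1⟩)
    change (a - a.1 0 • (1 : PolyRing V)) • x = 0 at h2
    rw [sub_smul, smul_assoc, one_smul, sub_eq_zero] at h2
    exact h2
  let g : PP t.r →ₗ[PolyRing V] (F.stalk Δ.ozero).M :=
    { toFun := fun f => PP.co 0 f • e
      map_add' := by intro f g; rw [PP.co_add, add_smul]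
      map_smul' := by
        intro a f
        rw [co_zero_smul, mul_smul, RingHom.id_apply, hact] }
  refine ⟨Submodule.liftQ _ g ?_, ?_⟩
  · intro f hf
    have h1 : PP.co 0 f = 0 := hf 0 ⟨by
      rw [Finsupp.support_zero]; exact TK_empty t, by simp⟩
    change PP.co 0 f • e = 0
    rw [h1, zero_smul]
  · intro x
    obtain ⟨c, rfl⟩ := he x
    refine ⟨Submodule.Quotient.mk (show PP t.r from (MvPolynomial.C c : MvPolynomial t.ι ℝ)), ?_⟩
    change PP.co 0 (show PP t.r from (MvPolynomial.C c : MvPolynomial t.ι ℝ)) • e = c • e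
    congr 1
    exact MvPolynomial.coeff_zero_C c

/-- An endomorphism of the sheaf acting on sections. -/
def secMap (χ : ∀ σ, (F.stalk σ).M →ₗ[PolyRing V] (F.stalk σ).M)
    (hχ : ∀ σ τ h x, (F.res σ τ h).toLin (χ σ x) = χ τ ((F.res σ τ h).toLin x))
    (Λ : Set (Cone V)) : F.Sec Λ →ₗ[PolyRing V] F.Sec Λ where
  toFun s := ⟨fun σ => χ σ (s.1 σ), by
    refine ⟨fun σ hσ => ?_, fun σ τ hσ hτ h => ?_⟩
    · change χ σ (s.1 σ) = 0
      rw [s.2.1 σ hσ, map_zero]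
    · rw [hχ, s.2.2 σ τ hσ hτ h]⟩
  map_add' s t := Subtype.ext (funext fun σ => map_add _ _ _)
  map_smul' a s := Subtype.ext (funext fun σ => map_smul _ _ _)

lemma secMap_quasi (χ : ∀ σ, (F.stalk σ).M →ₗ[PolyRing V] (F.stalk σ).M)
    (hχ : ∀ σ τ h x, (F.res σ τ h).toLin (χ σ x) = χ τ ((F.res σ τ h).toLin x))
    (Λ : Set (Cone V)) (h : ∀ σ : Δ.cones, σ.1 ∈ Λ → Quasi (χ σ)) : Quasi (secMap F χ hχ Λ) := by
  have : Fintype Δ.cones := Δ.finite.fintype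
  apply Quasi.of_family (ι := {σ : Δ.cones // σ.1 ∈ Λ}) (fun σ => (F.stalk σ.1).M)
    (fun σ => LinearMap.proj σ.1 ∘ₗ (F.secSub Λ).subtype) _ (fun σ => χ σ.1) (fun σ x => rfl)
    (fun σ => h σ.1 σ.2)
  intro s hs
  apply Subtype.ext
  funext σ
  by_cases hσ : σ.1 ∈ Λ
  · exact hs ⟨σ, hσ⟩
  · exact s.2.1 σ hσ

lemma stalk_quasi [FiniteDimensional ℝ V] (hF : F.IsMES)
    (χ : ∀ σ, (F.stalk σ).M →ₗ[PolyRing V] (F.stalk σ).M)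
    (hχ : ∀ σ τ h x, (F.res σ τ h).toLin (χ σ x) = χ τ ((F.res σ τ h).toLin x))
    (h0 : χ Δ.ozero = LinearMap.id) (σ : Δ.cones) : Quasi (χ σ) := by
  have : Fintype Δ.cones := Δ.finite.fintype
  have main : ∀ n : ℕ, ∀ σ : Δ.cones,
      (Finset.univ.filter fun τ : Δ.cones => τ.1.carrier ⊆ σ.1.carrier).card = n →
      Quasi (χ σ) := by
    intro n
    induction n using Nat.strong_induction_on with
    | _ n ih =>
    intro σ hσn
    have hfin := stalk_finite F hF σ
    apply Quasi.of_surj_mod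
    intro x
    by_cases hσ0 : σ = Δ.ozero
    · subst hσ0
      refine ⟨x, ?_⟩
      rw [h0, LinearMap.id_apply, sub_self]
      exact zero_mem _
    · have hσ0' : σ.1 ≠ zeroCone V := fun h => hσ0 (Subtype.ext h)
      have hq : Quasi (secMap F χ hχ (FanSheaf.bdFan σ)) := by
        apply secMap_quasi
        intro τ hτ
        refine ih _ ?_ τ rfl
        rw [← hσn]
        apply Finset.card_lt_card
        rw [Finset.ssubset_iff_of_subset]
        · refine ⟨σ, by simp, ?_⟩
          simp only [Finset.mem_filter, Finset.mem_univ, true_and]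
          intro hle
          exact hτ.2 (Cone.ext' (Set.Subset.antisymm (face_subset hτ.1) hle))
        · intro ρ
          simp only [Finset.mem_filter, Finset.mem_univ, true_and]
          exact fun h => h.trans (face_subset hτ.1)
      obtain ⟨s, hs⟩ := hq.surj_mod (F.bdRes σ x)
      obtain ⟨y, rfl⟩ := bdRes_surj' F hF σ hσ0' s
      refine ⟨y, bdRes_inj_mod F hF.2.2 σ hσ0' _ ?_⟩
      have h1 : F.bdRes σ (χ σ y) = secMap F χ hχ (FanSheaf.bdFan σ) (F.bdRes σ y) := by
        apply Subtype.ext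
        funext τ
        by_cases hτ : τ.1 ∈ FanSheaf.bdFan σ
        · rw [bdRes_apply F σ τ hτ]
          change _ = χ τ ((F.bdRes σ y).1 τ)
          rw [bdRes_apply F σ τ hτ, hχ]
        · rw [(F.bdRes σ (χ σ y)).2.1 τ hτ, (secMap F χ hχ (FanSheaf.bdFan σ) (F.bdRes σ y)).2.1 τ hτ]
      rw [map_sub, h1]
      exact hs
  exact main _ σ rfl

lemma stalk_glue [FiniteDimensional ℝ V] (hF : F.IsMES) (σ : Δ.cones) (hσ : σ.1 ≠ zeroCone V)
    (s : ∀ τ : {τ : Δ.cones // τ.1 ∈ FanSheaf.bdFan σ}, (F.stalk τ.1).M)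
    (hs : s ∈ cf (fun σ => (F.stalk σ).M) (fun σ τ h => (F.res σ τ h).toLin) (FanSheaf.bdFan σ)) :
    ∃ y : (F.stalk σ).M, ∀ τ : {τ : Δ.cones // τ.1 ∈ FanSheaf.bdFan σ},
      (F.res σ τ.1 τ.2.1).toLin y = s τ := by
  let s' : F.Sec (FanSheaf.bdFan σ) := ⟨fun τ => if h : τ.1 ∈ FanSheaf.bdFan σ then s ⟨τ, h⟩ else 0, by
    refine ⟨fun τ hτ => dif_neg hτ, fun τ υ hτ hυ h => ?_⟩
    have h1 : ∀ (ρ : Δ.cones) (hρ : ρ.1 ∈ FanSheaf.bdFan σ),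
        (if h : ρ.1 ∈ FanSheaf.bdFan σ then s ⟨ρ, h⟩ else 0) = s ⟨ρ, hρ⟩ := fun ρ hρ => dif_pos hρ
    refine (congrArg _ (h1 τ hτ)).trans (Eq.trans ?_ (h1 υ hυ).symm)
    exact hs ⟨τ, hτ⟩ ⟨υ, hυ⟩ h⟩
  obtain ⟨y, hy⟩ := bdRes_surj' F hF σ hσ s'
  refine ⟨y, fun τ => ?_⟩
  rw [← bdRes_apply F σ τ.1 τ.2, hy]
  exact dif_pos τ.2

theorem main [FiniteDimensional ℝ V] (hΔ : Δ.IsComplete) (hF : F.IsMES) :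
    Module.Free (PolyRing V) F.globalSec := by
  obtain ⟨t⟩ := exists_tri Δ hΔ
  have rYs : ∀ σ h x, (F.res σ σ h).toLin x = x := by
    intro σ h x; rw [F.res_self]; rfl
  have rYc : ∀ σ τ υ h1 h2 h3 x, (F.res τ υ h2).toLin ((F.res σ τ h1).toLin x) =
      (F.res σ υ h3).toLin x := by
    intro σ τ υ h1 h2 h3 x
    rw [← F.res_comp σ τ υ h1 h2 h3]; rfl
  have rXs : ∀ (σ : Δ.cones) (h : σ.1.IsFaceOf σ.1) (x : BB t σ.1.carrier),
      bres t (face_subset h) x = x := by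
    intro σ h x
    obtain ⟨f, rfl⟩ := Submodule.Quotient.mk_surjective _ x
    rfl
  have rXc : ∀ (σ τ υ : Δ.cones) (h1 : τ.1.IsFaceOf σ.1) (h2 : υ.1.IsFaceOf τ.1)
      (h3 : υ.1.IsFaceOf σ.1) (x : BB t σ.1.carrier),
      bres t (face_subset h2) (bres t (face_subset h1) x) = bres t (face_subset h3) x := by
    intro σ τ υ h1 h2 h3 x
    obtain ⟨f, rfl⟩ := Submodule.Quotient.mk_surjective _ x
    rfl
  obtain ⟨ψ0, hψ0⟩ := exists_psi0 F t hF.1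
  obtain ⟨ψ, hψo, hψ⟩ := exists_hom (Δ := Δ) (fun σ => BB t σ.1.carrier)
    (fun σ τ h => bres t (face_subset h)) rXs rXc (LP_BB_cone t)
    (fun σ => (F.stalk σ).M) (fun σ τ h => (F.res σ τ h).toLin) rYs rYc
    (fun σ a ha y => by
      obtain ⟨h, _⟩ := hF.2.1 σ
      exact h (x := y) (a := ⟨a, ha⟩))
    (fun σ hσ s hs => stalk_glue F hF σ hσ s hs) ψ0
  obtain ⟨φ0, hφ0⟩ := LP.of_freeOverCone _ (hF.2.1 Δ.ozero) _ _ ψ0 hψ0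
    (BB_torsion t _) LinearMap.id
  obtain ⟨φ, hφo, hφ⟩ := exists_hom (Δ := Δ)
    (fun σ => (F.stalk σ).M) (fun σ τ h => (F.res σ τ h).toLin) rYs rYc
    (fun σ => LP.of_freeOverCone _ (hF.2.1 σ))
    (fun σ => BB t σ.1.carrier)
    (fun σ τ h => bres t (face_subset h)) rXs rXc
    (fun σ => BB_torsion t σ.1)
    (fun σ hσ s hs => by
      obtain ⟨f, hf⟩ := BB_glue t (FanSheaf.bdFan σ) (bd_inter σ) (fun τ hτ => s ⟨τ, hτ⟩)
        (fun ρ τ hρ hτ h => hs ⟨ρ, hρ⟩ ⟨τ, hτ⟩ h)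
      exact ⟨Submodule.Quotient.mk f, fun τ => hf τ.1 τ.2⟩) φ0
  let χ : ∀ σ, (F.stalk σ).M →ₗ[PolyRing V] (F.stalk σ).M := fun σ => ψ σ ∘ₗ φ σ
  have hχ : ∀ σ τ h x, (F.res σ τ h).toLin (χ σ x) = χ τ ((F.res σ τ h).toLin x) := by
    intro σ τ h x
    change (F.res σ τ h).toLin (ψ σ (φ σ x)) = ψ τ (φ τ _)
    rw [hψ, hφ]
  have hχ0 : χ Δ.ozero = LinearMap.id := by
    change ψ Δ.ozero ∘ₗ φ Δ.ozero = _
    rw [hψo, hφo, hφ0]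
  have hq := secMap_quasi F χ hχ Δ.cones (fun σ _ => stalk_quasi F hF χ hχ hχ0 σ)
  obtain ⟨a, ha, g, hg⟩ := hq.factor
  -- the global maps
  have hglob : ∀ s : F.globalSec, ∃ b : BB t Set.univ, ∀ σ : Δ.cones,
      bres t (Set.subset_univ σ.1.carrier) b = φ σ (s.1 σ) := by
    intro s
    obtain ⟨f, hf⟩ := BB_glue t Δ.cones (by
      intro σ τ _ _
      obtain ⟨υ, hυ, h1, h2, h3⟩ := Δ.inter_mem σ.1 σ.2 τ.1 τ.2
      exact ⟨⟨υ, hυ⟩, hυ, h1, h2, h3⟩) (fun τ _ => φ τ (s.1 τ))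
      (fun ρ τ hρ hτ h => by rw [hφ _ _ h, s.2.2 ρ τ hρ hτ h])
    exact ⟨Submodule.Quotient.mk f, fun σ => hf σ σ.2⟩
  have huniq : ∀ b b' : BB t Set.univ, (∀ σ : Δ.cones, bres t (Set.subset_univ σ.1.carrier) b =
      bres t (Set.subset_univ σ.1.carrier) b') → b = b' := by
    intro b b' h
    rw [← sub_eq_zero]
    apply BB_univ_inj
    intro σ
    rw [map_sub, h, sub_self]
  choose Φ hΦ using hglob
  let φg : F.globalSec →ₗ[PolyRing V] BB t Set.univ :=
    { toFun := Φ
      map_add' := by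
        intro x y
        apply huniq
        intro σ
        rw [map_add, hΦ, hΦ, hΦ, ← map_add]
        rfl
      map_smul' := by
        intro c x
        apply huniq
        intro σ
        rw [RingHom.id_apply, map_smul, hΦ, hΦ, ← map_smul]
        rfl }
  let ψg : BB t Set.univ →ₗ[PolyRing V] F.globalSec :=
    LinearMap.codRestrict (F.secSub Δ.cones)
      (LinearMap.pi fun σ : Δ.cones => ψ σ ∘ₗ bres t (Set.subset_univ σ.1.carrier)) (by
        intro b
        refine ⟨fun σ hσ => absurd σ.2 hσ, fun σ τ hσ hτ h => ?_⟩
        change (F.res σ τ h).toLin (ψ σ (bres t _ b)) = ψ τ (bres t _ b)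
        rw [hψ]
        congr 1
        obtain ⟨f, rfl⟩ := Submodule.Quotient.mk_surjective _ b
        rfl)
  have hfin : Module.Finite (PolyRing V) F.globalSec :=
    sec_finite F _ fun σ _ => stalk_finite F hF σ
  refine free_of_factor (secGr F Δ.cones) a ha (BB t Set.univ) (LP_BB_univ t) (φg ∘ₗ g) ψg ?_
  intro x
  rw [hg x]
  apply Subtype.ext
  funext σ
  change ψ σ (φ σ ((g x).1 σ)) = ψ σ (bres t (Set.subset_univ σ.1.carrier) (Φ (g x)))
  rw [hΦ]

end final

end QC

/-- Every complete fan is quasi-convex: the module of global sections of a minimal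
extension sheaf on a complete fan is a free `A•`-module. -/
theorem complete_fan_quasiConvex
    {V : Type} [AddCommGroup V] [Module ℝ V] [FiniteDimensional ℝ V]
    {Δ : Fan V} (hΔ : Δ.IsComplete) (F : FanSheaf Δ) (hF : F.IsMES) :
    Module.Free (PolyRing V) F.globalSec := by
  exact QC.main F hΔ hF

end
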